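/- arXiv:1801.06815 — 10 statements merged into one kernel-verified Lean document; each statement's English description precedes it below -/
import Mathlib

section
/- Franklin's theorem: For every integer k ≥ 1, every nonnegative integer m, and every nonnegative integer n, the number of partitions of n having exactly m distinct part values each occurring k or more times equals the number of partitions of n having exactly m distinct part values divisible by k. -/
namespace Nat.Partition
open PowerSeries PowerSeries.WithPiTopology Finset

section GenFun

variable {R : Type*} [CommRing R] [TopologicalSpace R] [T2Space R] [IsTopologicalRing R]

/-- `1 + ∑ aⱼ y ^ j` times `1 - y`, where `aⱼ` is `1` for `j < k` and `t` for `k ≤ j`. -/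
theorem one_add_tsum_ite_le_mul_one_sub (t : R) {k : ℕ} (hk : 1 ≤ k) (i : ℕ) :
    (1 + ∑' j, (if k ≤ j + 1 then t else 1) • (X : R⟦X⟧) ^ ((i + 1) * (j + 1))) *
      (1 - X ^ (i + 1)) = 1 + (t - 1) • X ^ ((i + 1) * k) := by
  set y : R⟦X⟧ := X ^ (i + 1) with hy
  have hy0 : y.constantCoeff = 0 := by simp [hy]
  have hs : Summable (fun j ↦ y ^ j) := summable_pow_of_constantCoeff_eq_zero hy0
  have hmul : (∑' j, y ^ j) * (1 - y) = 1 := tsum_pow_mul_one_sub_of_constantCoeff_eq_zero hy0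
  have hshift : HasSum (fun j ↦ if k ≤ j then y ^ j else 0) ((∑' j, y ^ j) * y ^ k) := by
    rw [← hasSum_nat_add_iff' k, sum_eq_zero (fun j hj ↦ if_neg (by simpa using hj)), sub_zero]
    simpa [pow_add] using hs.hasSum.mul_right (y ^ k)
  have hsum := hs.hasSum.add (hshift.mul_left (C (t - 1)))
  have htotal : 1 + ∑' j, (if k ≤ j + 1 then t else 1) • (X : R⟦X⟧) ^ ((i + 1) * (j + 1)) =
      (∑' j, y ^ j) + C (t - 1) * ((∑' j, y ^ j) * y ^ k) := by
    rw [← hasSum_nat_add_iff' 1] at hsum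
    have hterm : (fun j ↦ (if k ≤ j + 1 then t else 1) • (X : R⟦X⟧) ^ ((i + 1) * (j + 1))) =
        fun j ↦ y ^ (j + 1) + C (t - 1) * (if k ≤ j + 1 then y ^ (j + 1) else 0) := by
      ext1 j
      rw [pow_mul, ← hy, smul_eq_C_mul]
      split_ifs <;> simp [sub_mul]
    rw [hterm, hsum.tsum_eq]
    simp [show k ≠ 0 by lia]
  rw [htotal, smul_eq_C_mul, pow_mul, ← hy]
  linear_combination (1 + C (t - 1) * y ^ k) * hmul

theorem one_add_tsum_smul_mul_one_sub (t : R) (i : ℕ) :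
    (1 + ∑' j, t • (X : R⟦X⟧) ^ ((i + 1) * (j + 1))) * (1 - X ^ (i + 1)) =
      1 + (t - 1) • X ^ (i + 1) := by
  simpa using one_add_tsum_ite_le_mul_one_sub (k := 1) t le_rfl i

variable [NoZeroDivisors R]

theorem genFun_ite_le_eq_genFun_ite_dvd (t : R) {k : ℕ} (hk : 1 ≤ k) :
    genFun (fun _ c ↦ if k ≤ c then t else 1) = genFun (fun i _ ↦ if k ∣ i then t else 1) := by
  nontriviality R
  apply mul_right_cancel₀ (tprod_one_sub_X_pow_ne_zero R)
  rw [genFun_eq_tprod, genFun_eq_tprod,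
    ← (multipliable_genFun fun _ c ↦ if k ≤ c then t else 1).tprod_mul
      (multipliable_one_sub_X_pow R),
    ← (multipliable_genFun fun i _ ↦ if k ∣ i then t else 1).tprod_mul
      (multipliable_one_sub_X_pow R)]
  simp_rw [one_add_tsum_ite_le_mul_one_sub t hk, one_add_tsum_smul_mul_one_sub]
  symm
  have hsucc (i : ℕ) : (i + 1) * k - 1 + 1 = (i + 1) * k :=
    Nat.sub_add_cancel (Nat.mul_pos i.succ_pos hk)
  refine tprod_eq_tprod_of_ne_one_bij (fun i ↦ (i.val + 1) * k - 1) ?_ ?_ ?_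
  · intro a b h
    have h' : (a.val + 1) * k = (b.val + 1) * k :=
      (hsucc a).symm.trans ((congrArg (· + 1) h).trans (hsucc b))
    exact SetCoe.ext (by simpa using Nat.eq_of_mul_eq_mul_right hk h')
  · intro i hi
    rw [Function.mem_mulSupport] at hi
    obtain ⟨j, hj⟩ : k ∣ i + 1 := by
      by_contra h
      simp [h] at hi
    obtain ⟨l, rfl⟩ : ∃ l, j = l + 1 := Nat.exists_eq_succ_of_ne_zero (by rintro rfl; simp at hj)
    refine ⟨⟨l, ?_⟩, Nat.sub_eq_of_eq_add (by rw [hj, mul_comm])⟩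
    rw [Function.mem_mulSupport]
    simpa [hj, mul_comm] using hi
  · intro i
    simp [hsucc]

end GenFun

theorem coeff_coeff_genFun_ite (p : ℕ → ℕ → Prop) [∀ i c, Decidable (p i c)] (m n : ℕ) :
    ((genFun (fun i c ↦ if p i c then (Polynomial.X : Polynomial ℤ) else 1)).coeff n).coeff m =
      Nat.card {c : n.Partition //
        (c.parts.toFinset.filter (fun i ↦ p i (c.parts.count i))).card = m} := by
  have hprod (c : n.Partition) :
      c.parts.toFinsupp.prod (fun i c ↦ if p i c then (Polynomial.X : Polynomial ℤ) else 1) =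
        Polynomial.X ^ (c.parts.toFinset.filter (fun i ↦ p i (c.parts.count i))).card := by
    rw [← prod_const, prod_filter]
    rfl
  simp [hprod, Polynomial.coeff_X_pow, Nat.card_eq_fintype_card, Fintype.card_subtype, eq_comm]

end Nat.Partition

/-- Franklin's theorem: for `k ≥ 1`, the number of partitions of `n` having exactly `m`
distinct part values each occurring `k` or more times equals the number of partitions of `n`
having exactly `m` distinct part values divisible by `k`. -/
theorem franklin (k m n : ℕ) (hk : 1 ≤ k) :
    Nat.card {c : n.Partition //
      (c.parts.toFinset.filter (fun i => k ≤ c.parts.count i)).card = m} =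
    Nat.card {c : n.Partition //
      (c.parts.toFinset.filter (fun i => k ∣ i)).card = m} := by
  let _ : TopologicalSpace (Polynomial ℤ) := ⊥
  have _ : DiscreteTopology (Polynomial ℤ) := ⟨rfl⟩
  have h := Nat.Partition.genFun_ite_le_eq_genFun_ite_dvd (Polynomial.X : Polynomial ℤ) hk
  have hcoeff := congrArg (fun F ↦ (F.coeff n).coeff m) h
  rw [Nat.Partition.coeff_coeff_genFun_ite (fun _ c ↦ k ≤ c),
    Nat.Partition.coeff_coeff_genFun_ite (fun i _ ↦ k ∣ i)] at hcoeff
  exact_mod_cast hcoeff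
end

section
/- For every n ≥ 1, the number of partitions of n having exactly one even part value (which may be repeated, all other parts being odd) equals the total number of parts counted over all partitions of n into odd parts minus the total number of parts counted over all partitions of n into distinct parts. -/
namespace Nat.Partition

open Finset

/-- Removing `m` copies of the part `i` identifies the partitions of `n` in which `i` occurs at
least `m` times with the partitions of `n - m * i`. -/
def removePartsEquiv {n m i : ℕ} (hi : 0 < i) (h : m * i ≤ n) :
    {c : n.Partition // Multiset.replicate m i ≤ c.parts} ≃ (n - m * i).Partition where
  toFun c :=
    { parts := c.1.parts - Multiset.replicate m i
      parts_pos := fun hx => c.1.parts_pos (Multiset.mem_of_le (Multiset.sub_le_self _ _) hx)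
      parts_sum := by
        have := congrArg Multiset.sum (Multiset.sub_add_cancel c.2)
        rw [Multiset.sum_add, c.1.parts_sum, Multiset.sum_replicate, smul_eq_mul] at this
        omega }
  invFun d :=
    ⟨{ parts := d.parts + Multiset.replicate m i
       parts_pos := fun hx => by
        rcases Multiset.mem_add.1 hx with hx | hx
        · exact d.parts_pos hx
        · rwa [Multiset.eq_of_mem_replicate hx]
       parts_sum := by
        rw [Multiset.sum_add, d.parts_sum, Multiset.sum_replicate, smul_eq_mul]
        omega }, Multiset.le_add_left _ _⟩
  left_inv c := Subtype.ext (Nat.Partition.ext (Multiset.sub_add_cancel c.2))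
  right_inv d := Nat.Partition.ext (Multiset.add_sub_cancel_right)

theorem card_filter_le_count_and {n m i : ℕ} (hi : 0 < i) (h : m * i ≤ n)
    (P : Multiset ℕ → Prop) [DecidablePred P] :
    #{c : n.Partition | m ≤ c.parts.count i ∧ P c.parts} =
      #{d : (n - m * i).Partition | P (d.parts + Multiset.replicate m i)} := by
  symm
  refine card_bij (fun d _ => ((removePartsEquiv hi h).symm d).1) ?_ ?_ ?_
  · intro d hd
    have := ((removePartsEquiv hi h).symm d).2
    rw [mem_filter] at hd ⊢
    exact ⟨mem_univ _, Multiset.le_count_iff_replicate_le.2 this, hd.2⟩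
  · exact fun d _ d' _ hdd' => (removePartsEquiv hi h).symm.injective (Subtype.ext hdd')
  · intro c hc
    rw [mem_filter, Multiset.le_count_iff_replicate_le] at hc
    have hs := (removePartsEquiv hi h).symm_apply_apply ⟨c, hc.2.1⟩
    refine ⟨removePartsEquiv hi h ⟨c, hc.2.1⟩, ?_, congrArg Subtype.val hs⟩
    rw [mem_filter]
    refine ⟨mem_univ _, ?_⟩
    have : c.parts - Multiset.replicate m i + Multiset.replicate m i = c.parts :=
      Multiset.sub_add_cancel hc.2.1
    change P (c.parts - Multiset.replicate m i + Multiset.replicate m i)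
    rw [this]
    exact hc.2.2

theorem count_mul_le {n : ℕ} (c : n.Partition) (i : ℕ) : c.parts.count i * i ≤ n := by
  obtain ⟨s, hs⟩ := Multiset.le_iff_exists_add.1
    (Multiset.le_count_iff_replicate_le.1 (le_refl (c.parts.count i)))
  have := congrArg Multiset.sum hs
  rw [c.parts_sum, Multiset.sum_add, Multiset.sum_replicate, smul_eq_mul] at this
  omega

theorem count_le {n : ℕ} (c : n.Partition) {i : ℕ} (hi : 0 < i) : c.parts.count i ≤ n :=
  (Nat.le_mul_of_pos_right _ hi).trans (c.count_mul_le i)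

theorem mem_Icc_of_mem_parts {n : ℕ} (c : n.Partition) {i : ℕ} (h : i ∈ c.parts) :
    i ∈ Icc 1 n :=
  mem_Icc.2 ⟨c.parts_pos h, c.le_of_mem_parts h⟩

theorem card_parts_eq_sum_count {n : ℕ} (c : n.Partition) :
    Multiset.card c.parts = ∑ i ∈ Icc 1 n, c.parts.count i :=
  (Multiset.sum_count_eq_card fun _ h => c.mem_Icc_of_mem_parts h).symm

theorem card_odds_le_count {n m i : ℕ} (hi : Odd i) :
    #{c ∈ odds n | m ≤ c.parts.count i} = if m * i ≤ n then #(odds (n - m * i)) else 0 := by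
  split_ifs with h
  · have := card_filter_le_count_and hi.pos h (fun s => ∀ x ∈ s, ¬ Even x)
    simp only [odds, restricted, filter_filter]
    simp only [and_comm (a := m ≤ _)] at this
    rw [this]
    congr 1
    refine filter_congr fun d _ => ?_
    simp only [Multiset.mem_add]
    refine ⟨fun H x hx => H x (.inl hx), fun H x hx => hx.elim (H x) fun hx => ?_⟩
    rwa [Multiset.eq_of_mem_replicate hx, Nat.not_even_iff_odd]
  · rw [Finset.card_eq_zero, filter_eq_empty_iff]
    exact fun c _ hc => h ((Nat.mul_le_mul_right i hc).trans (c.count_mul_le i))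

theorem sum_card_parts_odds (n : ℕ) :
    ∑ c ∈ odds n, Multiset.card c.parts =
      ∑ i ∈ Icc 1 n with Odd i, ∑ m ∈ Icc 1 n, if m * i ≤ n then #(odds (n - m * i)) else 0 := by
  simp_rw [card_parts_eq_sum_count]
  rw [sum_comm, sum_filter]
  refine sum_congr rfl fun i hi => ?_
  split_ifs with hodd
  · simp_rw [← card_odds_le_count hodd, card_filter]
    rw [sum_comm]
    refine sum_congr rfl fun c _ => ?_
    rw [← card_filter]
    have hc := c.count_le hodd.pos
    have : {m ∈ Icc 1 n | m ≤ c.parts.count i} = Icc 1 (c.parts.count i) := by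
      ext m; simp only [mem_filter, mem_Icc]; omega
    rw [this, Nat.card_Icc, Nat.add_sub_cancel]
  · refine sum_eq_zero fun c hc => Multiset.count_eq_zero.2 fun hic => hodd ?_
    exact Nat.not_even_iff_odd.1 ((mem_filter.1 hc).2 i hic)

theorem card_filter_even_eq_singleton_and_count_eq {n m i : ℕ} (hi : 0 < i) (hm : 0 < m)
    (he : Even i) :
    #{c : n.Partition | c.parts.toFinset.filter (fun x => Even x) = {i} ∧ c.parts.count i = m} =
      if m * i ≤ n then #(odds (n - m * i)) else 0 := by
  split_ifs with h
  · have := card_filter_le_count_and hi h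
      (fun s => s.toFinset.filter (fun x => Even x) = {i} ∧ s.count i = m)
    trans
    · refine (Eq.trans ?_ this)
      congr 1
      refine filter_congr fun d _ => ?_
      exact ⟨fun H => ⟨H.2.ge, H⟩, fun H => H.2⟩
    · congr 1
      refine filter_congr fun d _ => ?_
      simp only [Multiset.count_add, Multiset.count_replicate_self, Finset.ext_iff, mem_filter,
        Multiset.mem_toFinset, Multiset.mem_add, Multiset.mem_replicate, mem_singleton]
      constructor
      · rintro ⟨H, hc⟩ x hx hxe
        obtain rfl := (H x).1 ⟨.inl hx, hxe⟩
        have := Multiset.count_pos.2 hx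
        omega
      · intro H
        refine ⟨fun x => ⟨fun hx => hx.1.elim (fun h' => (H x h' hx.2).elim) (·.2), ?_⟩, ?_⟩
        · rintro rfl
          exact ⟨.inr ⟨hm.ne', rfl⟩, he⟩
        · have : d.parts.count i = 0 := Multiset.count_eq_zero.2 fun h' => H i h' he
          omega
  · rw [Finset.card_eq_zero, filter_eq_empty_iff]
    rintro c _ ⟨-, rfl⟩
    exact h (c.count_mul_le i)

theorem card_one_even_part_value (n : ℕ) :
    #{c : n.Partition | #(c.parts.toFinset.filter (fun i => Even i)) = 1} =
      ∑ i ∈ Icc 1 n with Even i, ∑ m ∈ Icc 1 n, if m * i ≤ n then #(odds (n - m * i)) else 0 := by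
  have key : ∀ i ∈ (Icc 1 n).filter (fun i => Even i), ∀ m ∈ Icc 1 n,
      (if m * i ≤ n then #(odds (n - m * i)) else 0) =
      #{c : n.Partition |
        c.parts.toFinset.filter (fun x => Even x) = {i} ∧ c.parts.count i = m} := by
    intro i hi m hm
    rw [mem_filter, mem_Icc] at hi
    rw [card_filter_even_eq_singleton_and_count_eq hi.1.1 (mem_Icc.1 hm).1 hi.2]
  rw [sum_congr rfl fun i hi => sum_congr rfl (key i hi), ← sum_product']
  rw [← card_biUnion]
  · congr 1
    ext c
    simp only [mem_filter, mem_univ, true_and, mem_biUnion, mem_product, card_eq_one, Prod.exists]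
    constructor
    · rintro ⟨i, hi⟩
      have hic := hi.ge (mem_singleton_self i)
      rw [mem_filter, Multiset.mem_toFinset] at hic
      have hIcc := c.mem_Icc_of_mem_parts hic.1
      exact ⟨i, _, ⟨⟨hIcc, hic.2⟩, mem_Icc.2 ⟨Multiset.count_pos.2 hic.1,
        c.count_le (mem_Icc.1 hIcc).1⟩⟩, hi, rfl⟩
    · rintro ⟨i, m, -, hi, -⟩
      exact ⟨i, hi⟩
  · rintro ⟨i, m⟩ - ⟨j, k⟩ - hne
    refine disjoint_left.2 fun c hc hc' => hne ?_
    simp only [mem_filter, mem_univ, true_and] at hc hc'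
    obtain rfl : i = j := singleton_injective (hc.1.symm.trans hc'.1)
    rw [← hc.2, ← hc'.2]

theorem card_distincts_mem_add {n i : ℕ} (hi : 0 < i) (h : i ≤ n) :
    #{c ∈ distincts n | i ∈ c.parts} + #{c ∈ distincts (n - i) | i ∈ c.parts} =
      #(distincts (n - i)) := by
  have := card_filter_le_count_and (m := 1) hi (by omega : 1 * i ≤ n) (fun s => s.Nodup)
  rw [one_mul] at this
  simp only [Multiset.one_le_count_iff_mem, Multiset.replicate_one] at this
  rw [← card_filter_add_card_filter_not (s := distincts (n - i))
    (fun c : (n - i).Partition => i ∈ c.parts), add_comm]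
  congr 1
  simp only [distincts, filter_filter]
  simp only [and_comm (a := i ∈ _)] at this
  rw [this]
  congr 1
  refine filter_congr fun d _ => ?_
  rw [add_comm, Multiset.singleton_add, Multiset.nodup_cons, and_comm]

theorem card_distincts_mem_eq_alternating_sum {n i : ℕ} (hi : 0 < i) (M : ℕ) :
    (#{c ∈ distincts n | i ∈ c.parts} : ℤ) =
      -(∑ m ∈ Icc 1 M, if m * i ≤ n then (-1) ^ m * (#(distincts (n - m * i)) : ℤ) else 0) +
      if M * i ≤ n then (-1) ^ M * (#{c ∈ distincts (n - M * i) | i ∈ c.parts} : ℤ) else 0 := by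
  induction M with
  | zero =>
    rw [Nat.zero_mul, Nat.sub_zero]
    simp
  | succ M ih =>
    rw [ih, sum_Icc_succ_top (by omega)]
    have hMi : (M + 1) * i = M * i + i := by ring
    split_ifs with h₁ h₂ h₂
    · have := card_distincts_mem_add (n := n - M * i) hi (by omega)
      rw [Nat.sub_sub, ← hMi] at this
      rw [← this]
      push_cast
      ring
    · have : #{c ∈ distincts (n - M * i) | i ∈ c.parts} = 0 := by
        rw [Finset.card_eq_zero, filter_eq_empty_iff]
        intro c _ hc
        have := c.le_of_mem_parts hc
        omega
      simp [this]
    · omega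
    · simp

theorem sum_card_parts_distincts (n : ℕ) :
    ∑ c ∈ distincts n, (Multiset.card c.parts : ℤ) =
      -∑ i ∈ Icc 1 n, ∑ m ∈ Icc 1 n,
        if m * i ≤ n then (-1) ^ m * (#(odds (n - m * i)) : ℤ) else 0 := by
  simp_rw [card_parts_eq_sum_count, Nat.cast_sum]
  rw [sum_comm, ← sum_neg_distrib]
  refine sum_congr rfl fun i hi => ?_
  have hi := (mem_Icc.1 hi).1
  simp_rw [card_odds_eq_card_distincts]
  have h := card_distincts_mem_eq_alternating_sum (n := n) hi n
  have hzero : (if n * i ≤ n then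
      (-1) ^ n * (#{c ∈ distincts (n - n * i) | i ∈ c.parts} : ℤ) else 0) = 0 := by
    have : #{c ∈ distincts (n - n * i) | i ∈ c.parts} = 0 := by
      rw [Finset.card_eq_zero, filter_eq_empty_iff]
      intro c _ hc
      have := c.le_of_mem_parts hc
      have := Nat.le_mul_of_pos_right n hi
      omega
    simp [this]
  rw [hzero, add_zero] at h
  rw [← h, card_filter, Nat.cast_sum]
  refine sum_congr rfl fun c hc => ?_
  rw [Multiset.count_eq_of_nodup (mem_filter.1 hc).2]

end Nat.Partition

/-- For `n ≥ 1`, the number of partitions of `n` having exactly one even part value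
(possibly repeated, all other parts odd) equals the total number of parts over all odd
partitions of `n` minus the total number of parts over all distinct partitions of `n`. -/
theorem beck_conjecture_one (n : ℕ) (hn : 1 ≤ n) :
    (Nat.card {c : n.Partition //
        (c.parts.toFinset.filter (fun i => Even i)).card = 1} : ℤ) =
      (∑ c ∈ Nat.Partition.odds n, (Multiset.card c.parts : ℤ)) -
      (∑ c ∈ Nat.Partition.distincts n, (Multiset.card c.parts : ℤ)) := by
  open Finset Nat.Partition in
  rw [Nat.card_eq_fintype_card, Fintype.card_subtype, card_one_even_part_value,
    sum_card_parts_distincts, ← Nat.cast_sum, sum_card_parts_odds, sum_filter, sum_filter]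
  push_cast
  rw [sub_neg_eq_add, sum_comm (f := fun i m =>
    if m * i ≤ n then (-1) ^ m * (#(odds (n - m * i)) : ℤ) else 0), ← sum_add_distrib]
  refine sum_congr rfl fun i _ => ?_
  by_cases hi : Even i
  · rw [if_pos hi, if_neg (Nat.not_odd_iff_even.2 hi), zero_add]
    refine sum_congr rfl fun m _ => ?_
    rw [mul_comm i m, hi.neg_one_pow, one_mul]
  · have ho := Nat.not_even_iff_odd.1 hi
    rw [if_neg hi, if_pos ho, ← sum_add_distrib]
    refine (sum_eq_zero fun m _ => ?_).symm
    rw [mul_comm i m, ho.neg_one_pow]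
    split_ifs <;> simp
end

section
/- For every k ≥ 2 and n ≥ 0, (k−1) times the number of partitions of n having exactly one distinct part value divisible by k (this part possibly repeated) equals the sum of ℓ(λ) over all λ in O_k(n) minus the sum of ℓ(λ) over all λ in D_k(n). -/
open PowerSeries in
theorem PowerSeries.smul_pow_X_pow {R : Type*} [CommSemiring R] (a : R) (i j : ℕ) :
    a ^ j • (X : R⟦X⟧) ^ (i * j) = (C a * X ^ i) ^ j := by
  rw [smul_eq_C_mul, mul_pow, ← pow_mul, map_pow]

namespace Nat.Partition

open PowerSeries Finset
open scoped PowerSeries.WithPiTopology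

section GenFun

variable {R : Type*} [CommRing R]

/-- The generating function of partitions with no part divisible by `k`, weighted by
`z ^ (number of parts)`. -/
noncomputable def regularGenFun (k : ℕ) (z : R) : R⟦X⟧ :=
  genFun fun i c ↦ if ¬ k ∣ i then z ^ c else 0

/-- The generating function of partitions in which each part occurs fewer than `k` times, weighted
by `z ^ (number of parts)`. -/
noncomputable def countRestrictedGenFun (k : ℕ) (z : R) : R⟦X⟧ :=
  genFun fun _ c ↦ if c < k then z ^ c else 0

/-- The generating function of partitions weighted by
`b ^ (number of distinct part values divisible by k)`. -/
noncomputable def dvdPartsGenFun (k : ℕ) (b : R) : R⟦X⟧ :=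
  genFun fun i _ ↦ if k ∣ i then b else 1

theorem coeff_regularGenFun (k : ℕ) (z : R) (n : ℕ) :
    (regularGenFun k z).coeff n =
      ∑ c : n.Partition with ∀ p ∈ c.parts, ¬ k ∣ p, z ^ Multiset.card c.parts := by
  rw [regularGenFun, coeff_genFun, sum_filter]
  refine sum_congr rfl fun c _ ↦ ?_
  rw [Finsupp.prod, prod_ite_zero, prod_pow_eq_pow_sum]
  simp

theorem coeff_countRestrictedGenFun (k : ℕ) (z : R) (n : ℕ) :
    (countRestrictedGenFun k z).coeff n =
      ∑ c : n.Partition with ∀ i ∈ c.parts, c.parts.count i < k, z ^ Multiset.card c.parts := by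
  rw [countRestrictedGenFun, coeff_genFun, sum_filter]
  refine sum_congr rfl fun c _ ↦ ?_
  rw [Finsupp.prod, prod_ite_zero, prod_pow_eq_pow_sum]
  simp

theorem coeff_dvdPartsGenFun (k : ℕ) (b : R) (n : ℕ) :
    (dvdPartsGenFun k b).coeff n =
      ∑ c : n.Partition, b ^ (c.parts.toFinset.filter (k ∣ ·)).card := by
  rw [dvdPartsGenFun, coeff_genFun]
  refine sum_congr rfl fun c _ ↦ ?_
  rw [Finsupp.prod, prod_ite]
  simp

variable [TopologicalSpace R]

theorem multipliable_one_sub_C_mul_X_pow (a : R) :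
    Multipliable fun i ↦ (1 : R⟦X⟧) - C a * X ^ (i + 1) := by
  nontriviality R
  simp_rw [sub_eq_add_neg]
  apply WithPiTopology.multipliable_one_add_of_tendsto_order_atTop_nhds_top
  refine ENat.tendsto_nhds_top_iff_natCast_lt.mpr fun n ↦ Filter.eventually_atTop.mpr ⟨n, ?_⟩
  intro m hm
  grw [order_neg, ← le_order_mul, order_X_pow]
  refine lt_add_of_nonneg_of_lt (by simp) ?_
  norm_cast
  lia

theorem one_add_tsum_truncated_geom_mul_one_sub {k : ℕ} (hk : 0 < k) (a : R) (i : ℕ) :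
    (1 + ∑' j, (if j + 1 < k then a ^ (j + 1) else 0) • (X : R⟦X⟧) ^ ((i + 1) * (j + 1))) *
      (1 - C a * X ^ (i + 1)) = 1 - C (a ^ k) * X ^ ((i + 1) * k) := by
  obtain ⟨k, rfl⟩ := Nat.exists_eq_add_one_of_ne_zero hk.ne'
  have h : 1 + ∑' j, (if j + 1 < k + 1 then a ^ (j + 1) else 0) •
      (X : R⟦X⟧) ^ ((i + 1) * (j + 1)) = ∑ j ∈ range (k + 1), (C a * X ^ (i + 1)) ^ j := by
    rw [tsum_eq_sum (s := range k) fun j hj ↦ by simp_all, sum_range_succ', add_comm, pow_zero]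
    congr 1
    refine sum_congr rfl fun j hj ↦ ?_
    rw [if_pos (by simpa using hj), smul_pow_X_pow]
  rw [h, geom_sum_mul_neg, ← smul_pow_X_pow, smul_eq_C_mul]

variable [T2Space R] [IsTopologicalRing R]

theorem one_add_tsum_geom_mul_one_sub (a : R) (i : ℕ) :
    (1 + ∑' j, a ^ (j + 1) • (X : R⟦X⟧) ^ ((i + 1) * (j + 1))) * (1 - C a * X ^ (i + 1)) = 1 := by
  have h : constantCoeff (C a * X ^ (i + 1) : R⟦X⟧) = 0 := by simp
  have hgeom := WithPiTopology.tsum_pow_mul_one_sub_of_constantCoeff_eq_zero h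
  rw [(WithPiTopology.summable_pow_of_constantCoeff_eq_zero h).tsum_eq_zero_add, pow_zero] at hgeom
  simpa only [smul_pow_X_pow] using hgeom

theorem hasProd_regularGenFun_mul (k : ℕ) (z : R) :
    HasProd (fun i ↦ if k ∣ i + 1 then 1 - C z * X ^ (i + 1) else 1)
      (regularGenFun k z * ∏' i, (1 - C z * X ^ (i + 1))) := by
  convert! (hasProd_genFun fun i c ↦ if ¬ k ∣ i then z ^ c else 0).mul
    (multipliable_one_sub_C_mul_X_pow z).hasProd using 2 with i
  split_ifs with h
  · simp
  · rw [one_add_tsum_geom_mul_one_sub]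

theorem hasProd_countRestrictedGenFun_mul {k : ℕ} (hk : 0 < k) (z : R) :
    HasProd (fun i ↦ if k ∣ i + 1 then 1 - C (z ^ k) * X ^ (i + 1) else 1)
      (countRestrictedGenFun k z * ∏' i, (1 - C z * X ^ (i + 1))) := by
  have hsucc (i : ℕ) : (i + 1) * k - 1 + 1 = (i + 1) * k :=
    Nat.sub_add_cancel (Nat.mul_pos i.succ_pos hk)
  have hinj : Function.Injective fun i ↦ (i + 1) * k - 1 := fun i j h ↦ by
    have heq : (i + 1) * k = (j + 1) * k := by rw [← hsucc, ← hsucc j]; exact congrArg (· + 1) h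
    simpa [hk.ne'] using heq
  rw [← hinj.hasProd_iff]
  · convert! (hasProd_genFun fun _ c ↦ if c < k then z ^ c else 0).mul
      (multipliable_one_sub_C_mul_X_pow z).hasProd using 2 with i
    rw [one_add_tsum_truncated_geom_mul_one_sub hk]
    simp [hsucc]
  · intro i hi
    refine if_neg fun ⟨j, hj⟩ ↦ hi ⟨j - 1, ?_⟩
    have hj0 : j ≠ 0 := by rintro rfl; simp at hj
    simp only [Nat.sub_add_cancel (Nat.one_le_iff_ne_zero.mpr hj0), mul_comm j, ← hj,
      Nat.add_sub_cancel]

theorem hasProd_dvdPartsGenFun_mul (k : ℕ) (b : R) :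
    HasProd (fun i ↦ if k ∣ i + 1 then 1 - X ^ (i + 1) + C b * X ^ (i + 1) else 1)
      (dvdPartsGenFun k b * ∏' i, (1 - C 1 * X ^ (i + 1))) := by
  convert! (hasProd_genFun fun i _ ↦ if k ∣ i then b else 1).mul
    (multipliable_one_sub_C_mul_X_pow 1).hasProd using 2 with i
  have h := one_add_tsum_geom_mul_one_sub (1 : R) i
  simp only [one_pow, one_smul, map_one, one_mul] at h
  split_ifs
  · have hsum : Summable fun j ↦ (X : R⟦X⟧) ^ ((i + 1) * (j + 1)) := by
      simpa using summable_genFun_term (fun _ _ ↦ (1 : R)) i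
    simp_rw [smul_eq_C_mul]
    rw [hsum.tsum_mul_left, map_one, one_mul]
    linear_combination -C b * h
  · simpa using h.symm

theorem isUnit_tprod_one_sub_C_mul_X_pow (a : R) :
    IsUnit (∏' i, ((1 : R⟦X⟧) - C a * X ^ (i + 1))) := by
  refine .of_mul_eq_one (genFun fun _ c ↦ a ^ c) ?_
  have h := (multipliable_one_sub_C_mul_X_pow a).hasProd.mul (hasProd_genFun fun _ c ↦ a ^ c)
  simp only [mul_comm (1 - C a * X ^ _), one_add_tsum_geom_mul_one_sub] at h
  exact h.unique hasProd_one

/-- The first-order expansion at `z = 1` of the quotient of `regularGenFun k z` by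
`countRestrictedGenFun k z`. -/
theorem regularGenFun_mul_regularGenFun_one {k : ℕ} (hk : 0 < k) {e : R} (he : e * e = 0) :
    regularGenFun k (1 + e) * regularGenFun k (1 : R) =
      countRestrictedGenFun k (1 + e) * dvdPartsGenFun k ((k - 1 : R) * e) := by
  have hpow (m : ℕ) : (1 + e) ^ m = 1 + m * e := by
    induction m with
    | zero => simp
    | succ m ih => rw [pow_succ, ih]; push_cast; linear_combination (m : R) * he
  have hC : (C e : R⟦X⟧) * C e = 0 := by
    simpa using congrArg (C (R := R)) he
  apply ((isUnit_tprod_one_sub_C_mul_X_pow (1 + e)).mul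
    (isUnit_tprod_one_sub_C_mul_X_pow (1 : R))).mul_right_cancel
  rw [mul_mul_mul_comm, mul_mul_mul_comm (countRestrictedGenFun _ _)]
  refine ((hasProd_regularGenFun_mul k (1 + e)).mul (hasProd_regularGenFun_mul k 1)).unique ?_
  convert! (hasProd_countRestrictedGenFun_mul hk (1 + e)).mul
    (hasProd_dvdPartsGenFun_mul k ((k - 1 : R) * e)) using 2 with i
  split_ifs
  · rw [hpow]
    simp only [map_add, map_one, map_mul, map_sub, map_natCast]
    linear_combination (k * (k - 1) * (X : R⟦X⟧) ^ (i + 1) * (X : R⟦X⟧) ^ (i + 1)) * hC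
  · rfl

end GenFun

section DualNumber

open TrivSqZeroExt

theorem eq_add_of_dualNumber_mul_eq_mul {A B D E : (DualNumber ℤ)⟦X⟧} {o a d e : ℤ⟦X⟧} (ho : o ≠ 0)
    (hA : ∀ N, coeff N A = inl (coeff N o) + inr (coeff N a))
    (hB : ∀ N, coeff N B = inl (coeff N o))
    (hD : ∀ N, coeff N D = inl (coeff N o) + inr (coeff N d))
    (hE : ∀ N, coeff N E = inl (coeff N o) + inr (coeff N e)) (h : A * B = D * E) : a = d + e := by
  refine mul_right_cancel₀ ho (PowerSeries.ext fun N ↦ ?_)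
  replace h := congrArg (fun f ↦ snd (coeff N f)) h
  simp only [coeff_mul, hA, hB, hD, hE] at h
  simp only [snd_sum, snd_mul, fst_add, fst_inl, fst_inr, snd_add, snd_inl, snd_inr, mul_zero,
    zero_add, add_zero, smul_eq_mul, op_smul_eq_smul, sum_add_distrib] at h
  rw [add_mul, mul_comm e, map_add, coeff_mul, coeff_mul, coeff_mul]
  simpa only [mul_comm, add_comm] using h

theorem coeff_regularGenFun_one_add_eps (k n : ℕ) :
    (regularGenFun k (1 + DualNumber.eps : DualNumber ℤ)).coeff n =
      inl (#(restricted n (¬ k ∣ ·)) : ℤ) +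
      inr (∑ c : n.Partition with ∀ p ∈ c.parts, ¬ k ∣ p, (Multiset.card c.parts : ℤ)) := by
  ext <;> simp [coeff_regularGenFun, restricted, fst_sum, snd_sum]

theorem coeff_regularGenFun_one (k n : ℕ) :
    (regularGenFun k (1 : DualNumber ℤ)).coeff n = inl (#(restricted n (¬ k ∣ ·)) : ℤ) := by
  ext <;> simp [coeff_regularGenFun, restricted]

theorem coeff_countRestrictedGenFun_one_add_eps (k n : ℕ) :
    (countRestrictedGenFun k (1 + DualNumber.eps : DualNumber ℤ)).coeff n =
      inl (#(countRestricted n k) : ℤ) +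
      inr (∑ c : n.Partition with ∀ i ∈ c.parts, c.parts.count i < k,
        (Multiset.card c.parts : ℤ)) := by
  ext <;> simp [coeff_countRestrictedGenFun, countRestricted, fst_sum, snd_sum]

theorem coeff_dvdPartsGenFun_mul_eps (k n : ℕ) (b : ℤ) :
    (dvdPartsGenFun k (inl b * DualNumber.eps : DualNumber ℤ)).coeff n =
      inl (#(restricted n (¬ k ∣ ·)) : ℤ) +
      inr (b * #{c : n.Partition | #(c.parts.toFinset.filter (k ∣ ·)) = 1}) := by
  have snd_pow (r : ℕ) : snd ((inl b * DualNumber.eps : DualNumber ℤ) ^ r) =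
      b * ((if r = 1 then 1 else 0 : ℕ) : ℤ) := by
    rcases r with _ | _ | r <;> simp
  rw [coeff_dvdPartsGenFun]
  ext
  · simp [restricted, fst_sum, zero_pow_eq, sum_boole, filter_eq_empty_iff]
  · rw [snd_sum]
    simp only [snd_add, snd_inl, snd_inr, zero_add, card_filter _ univ, Nat.cast_sum, mul_sum,
      snd_pow]

end DualNumber

theorem sum_card_regular_eq_sum_card_countRestricted_add {k : ℕ} (hk : 0 < k) (n : ℕ) :
    ∑ c : n.Partition with ∀ p ∈ c.parts, ¬ k ∣ p, (Multiset.card c.parts : ℤ) =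
      ∑ c : n.Partition with ∀ i ∈ c.parts, c.parts.count i < k, (Multiset.card c.parts : ℤ) +
      (k - 1) * #{c : n.Partition | #(c.parts.toFinset.filter (k ∣ ·)) = 1} := by
  let o : ℤ⟦X⟧ := PowerSeries.mk fun n ↦ (#(restricted n (¬ k ∣ ·)) : ℤ)
  let a : ℤ⟦X⟧ := PowerSeries.mk fun n ↦
    ∑ c : n.Partition with ∀ p ∈ c.parts, ¬ k ∣ p, (Multiset.card c.parts : ℤ)
  let d : ℤ⟦X⟧ := PowerSeries.mk fun n ↦
    ∑ c : n.Partition with ∀ i ∈ c.parts, c.parts.count i < k, (Multiset.card c.parts : ℤ)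
  let e : ℤ⟦X⟧ := PowerSeries.mk fun n ↦
    (k - 1) * (#{c : n.Partition | #(c.parts.toFinset.filter (k ∣ ·)) = 1} : ℤ)
  have ho : o ≠ 0 := fun h ↦ by simpa [o, restricted] using congrArg (coeff 0) h
  have hb : ((k : DualNumber ℤ) - 1) = TrivSqZeroExt.inl (k - 1 : ℤ) := by ext <;> simp
  have key := regularGenFun_mul_regularGenFun_one hk (DualNumber.eps_mul_eps (R := ℤ))
  rw [hb] at key
  have h : a = d + e := by
    refine eq_add_of_dualNumber_mul_eq_mul ho (fun N ↦ ?_) (fun N ↦ ?_) (fun N ↦ ?_)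
      (fun N ↦ ?_) key
    · rw [coeff_regularGenFun_one_add_eps, coeff_mk, coeff_mk]
    · rw [coeff_regularGenFun_one, coeff_mk]
    · rw [coeff_countRestrictedGenFun_one_add_eps, coeff_mk, coeff_mk,
        card_restricted_eq_card_countRestricted N hk]
    · rw [coeff_dvdPartsGenFun_mul_eps, coeff_mk, coeff_mk]
  simpa only [a, d, e, coeff_mk, map_add] using congrArg (coeff n) h

end Nat.Partition

/-- For `k ≥ 2` and `n ≥ 0`, `(k-1)` times the number of partitions of `n` having exactly one
distinct part value divisible by `k` equals the total number of parts over all partitions of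
`n` with no part divisible by `k` minus the total number of parts over all partitions of `n`
in which every part occurs fewer than `k` times. -/
theorem beck_conjecture_one_generalized (k n : ℕ) (hk : 2 ≤ k) :
    ((k : ℤ) - 1) * (Nat.card {c : n.Partition //
        (c.parts.toFinset.filter (fun i => k ∣ i)).card = 1} : ℤ) =
      (∑ c ∈ Finset.univ.filter (fun c : n.Partition => ∀ p ∈ c.parts, ¬ k ∣ p),
          (Multiset.card c.parts : ℤ)) -
      (∑ c ∈ Finset.univ.filter (fun c : n.Partition => ∀ i ∈ c.parts, c.parts.count i < k),
          (Multiset.card c.parts : ℤ)) := by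
  rw [Nat.Partition.sum_card_regular_eq_sum_card_countRestricted_add (by lia),
    Nat.card_eq_fintype_card, Fintype.card_subtype]
  ring
end

section
/- Glaisher's bijection: For k ≥ 2 and n ≥ 0, the map φ sending a partition λ ∈ O_k(n) with multiplicities m_i (the number of parts equal to i) to the partition of n in which, for each part value i of λ and each j ≥ 0, the part i·k^j occurs with multiplicity equal to the j-th base-k digit of m_i, is a well-defined bijection from O_k(n) onto D_k(n). -/
namespace Nat

theorem sum_range_div_pow_mod_mul_pow (k m N : ℕ) :
    ∑ j ∈ Finset.range N, m / k ^ j % k * k ^ j = m % k ^ N := by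
  induction N with
  | zero => simp [Nat.mod_one]
  | succ N ih => rw [Finset.sum_range_succ, ih, Nat.mod_pow_succ, Nat.mul_comm (k ^ N)]

theorem mul_pow_inj_of_not_dvd {k i i' j j' : ℕ} (hk : 0 < k) (hi : ¬ k ∣ i) (hi' : ¬ k ∣ i')
    (h : i * k ^ j = i' * k ^ j') : i = i' ∧ j = j' := by
  wlog hj : j ≤ j' generalizing i i' j j'
  · exact (this hi' hi h.symm (le_of_not_ge hj)).imp Eq.symm Eq.symm
  obtain ⟨d, rfl⟩ := Nat.exists_eq_add_of_le hj
  have h' : i = i' * k ^ d := by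
    apply Nat.eq_of_mul_eq_mul_right (Nat.pow_pos hk : 0 < k ^ j)
    rw [h]; ring
  rcases d with _ | d
  · simpa using h'
  · exact absurd ⟨i' * k ^ d, by rw [h']; ring⟩ hi

namespace Partition

/-- The multiset in which, for each element `i` of `s`, the number `i * k ^ j` is repeated as many
times as the `j`-th base-`k` digit of the multiplicity of `i` in `s`, for `j < N`. -/
def glaisherParts (k N : ℕ) (s : Multiset ℕ) : Multiset ℕ :=
  ∑ i ∈ s.toFinset, ∑ j ∈ Finset.range N,
    Multiset.replicate (s.count i / k ^ j % k) (i * k ^ j)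

theorem exists_of_mem_glaisherParts {k N p : ℕ} {s : Multiset ℕ}
    (hp : p ∈ glaisherParts k N s) : ∃ i ∈ s, ∃ j, p = i * k ^ j := by
  simp only [glaisherParts, Multiset.mem_sum, Multiset.mem_toFinset] at hp
  obtain ⟨i, hi, j, -, h⟩ := hp
  exact ⟨i, hi, j, Multiset.eq_of_mem_replicate h⟩

theorem sum_glaisherParts {k N : ℕ} {s : Multiset ℕ} (hs : ∀ i, s.count i < k ^ N) :
    (glaisherParts k N s).sum = s.sum := by
  simp only [glaisherParts, Multiset.sum_sum, Multiset.sum_replicate, smul_eq_mul]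
  rw [Finset.sum_multiset_count]
  refine Finset.sum_congr rfl fun i _ => ?_
  have h := sum_range_div_pow_mod_mul_pow k (s.count i) N
  rw [Nat.mod_eq_of_lt (hs i)] at h
  conv_rhs => rw [smul_eq_mul, ← h, Finset.sum_mul]
  exact Finset.sum_congr rfl fun j _ => by ring

theorem count_glaisherParts {k N i j : ℕ} {s : Multiset ℕ} (hk : 0 < k)
    (hs : ∀ p ∈ s, ¬ k ∣ p) (hN : ∀ i, s.count i < k ^ N) (hi : ¬ k ∣ i) :
    (glaisherParts k N s).count (i * k ^ j) = s.count i / k ^ j % k := by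
  simp only [glaisherParts, Multiset.count_sum', Multiset.count_replicate]
  rw [Finset.sum_eq_single i, Finset.sum_eq_single j]
  · simp
  · intro j' _ hne
    exact if_neg fun h => hne (mul_pow_inj_of_not_dvd hk hi hi h).2
  · intro hj
    have hle : k ^ N ≤ k ^ j := Nat.pow_le_pow_right hk (by simpa using hj)
    simp [Nat.div_eq_of_lt ((hN i).trans_le hle)]
  · intro i' hi' hne
    exact Finset.sum_eq_zero fun j' _ => if_neg fun h =>
      hne (mul_pow_inj_of_not_dvd hk (hs i' (Multiset.mem_toFinset.mp hi')) hi h).1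
  · intro h
    simp [Multiset.count_eq_zero.mpr (mt Multiset.mem_toFinset.mpr h)]

theorem count_parts_le {n : ℕ} (c : n.Partition) (i : ℕ) : c.parts.count i ≤ n := by
  refine (Multiset.count_le_card i c.parts).trans ?_
  have h := Multiset.card_nsmul_le_sum (s := c.parts) (a := 1) fun x hx => c.parts_pos hx
  simpa [c.parts_sum] using h

theorem count_parts_lt_pow {k n : ℕ} (hk : 2 ≤ k) (c : n.Partition) (i : ℕ) :
    c.parts.count i < k ^ n :=
  (c.count_parts_le i).trans_lt (Nat.lt_pow_self hk)

/-- Glaisher's map from partitions with no part divisible by `k` to partitions in which every part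
occurs fewer than `k` times. -/
def glaisher {k n : ℕ} (hk : 2 ≤ k) (c : {c : n.Partition // ∀ p ∈ c.parts, ¬ k ∣ p}) :
    {c : n.Partition // ∀ i ∈ c.parts, c.parts.count i < k} where
  val :=
    { parts := glaisherParts k n c.1.parts
      parts_pos := fun hp => by
        obtain ⟨i, hi, j, rfl⟩ := exists_of_mem_glaisherParts hp
        exact Nat.mul_pos (c.1.parts_pos hi) (Nat.pow_pos (by lia))
      parts_sum := by rw [sum_glaisherParts (c.1.count_parts_lt_pow hk), c.1.parts_sum] }
  property := fun p hp => by
    obtain ⟨i, hi, j, rfl⟩ := exists_of_mem_glaisherParts hp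
    rw [count_glaisherParts (by lia) c.2 (c.1.count_parts_lt_pow hk) (c.2 i hi)]
    exact Nat.mod_lt _ (by lia)

theorem count_glaisher {k n i : ℕ} (hk : 2 ≤ k)
    (c : {c : n.Partition // ∀ p ∈ c.parts, ¬ k ∣ p}) (j : ℕ) (hi : ¬ k ∣ i) :
    (glaisher hk c).1.parts.count (i * k ^ j) = c.1.parts.count i / k ^ j % k :=
  count_glaisherParts (by lia) c.2 (c.1.count_parts_lt_pow hk) hi

theorem glaisher_injective {k n : ℕ} (hk : 2 ≤ k) :
    Function.Injective (glaisher (n := n) hk) := by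
  intro c d h
  refine Subtype.ext (Nat.Partition.ext (Multiset.ext.mpr fun i => ?_))
  by_cases hi : k ∣ i
  · rw [Multiset.count_eq_zero.mpr fun hc => c.2 i hc hi,
      Multiset.count_eq_zero.mpr fun hd => d.2 i hd hi]
  · rw [← Nat.mod_eq_of_lt (c.1.count_parts_lt_pow hk i),
      ← Nat.mod_eq_of_lt (d.1.count_parts_lt_pow hk i),
      ← sum_range_div_pow_mod_mul_pow, ← sum_range_div_pow_mod_mul_pow]
    refine Finset.sum_congr rfl fun j _ => ?_
    rw [← count_glaisher hk c j hi, ← count_glaisher hk d j hi, h]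

theorem glaisher_bijective {k n : ℕ} (hk : 2 ≤ k) :
    Function.Bijective (glaisher (n := n) hk) := by
  refine (Fintype.bijective_iff_injective_and_card _).mpr ⟨glaisher_injective hk, ?_⟩
  rw [Fintype.card_subtype, Fintype.card_subtype]
  exact card_restricted_eq_card_countRestricted n (by lia)

end Partition

end Nat

/-- Glaisher's bijection: for `k ≥ 2`, there is a bijection `φ` from the partitions of `n`
with no part divisible by `k` onto the partitions of `n` in which every part occurs fewer
than `k` times, such that for every part value `i` not divisible by `k` and every `j ≥ 0`,
the part `i·k^j` occurs in `φ(λ)` with multiplicity the `j`-th base-`k` digit of the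
multiplicity of `i` in `λ`. -/
theorem glaisher_bijection (k n : ℕ) (hk : 2 ≤ k) :
    ∃ e : {c : n.Partition // ∀ p ∈ c.parts, ¬ k ∣ p} ≃
          {c : n.Partition // ∀ i ∈ c.parts, c.parts.count i < k},
      ∀ c : {c : n.Partition // ∀ p ∈ c.parts, ¬ k ∣ p}, ∀ i j : ℕ, ¬ k ∣ i →
        (e c).1.parts.count (i * k ^ j) =
          (Nat.digits k (c.1.parts.count i)).getD j 0 := by
  refine ⟨Equiv.ofBijective _ (Nat.Partition.glaisher_bijective hk), fun c i j hi => ?_⟩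
  rw [Nat.getD_digits _ _ hk]
  exact Nat.Partition.count_glaisher hk c j hi
end

section
/- For every k ≥ 1 and n ≥ 0, the number of partitions of n in which exactly one part value occurs more than k times and fewer than 2k times while every other part value occurs fewer than k times equals the sum of ℓ̄(λ) over all λ in D_k(n) minus the sum of ℓ̄(λ) over all λ in O_k(n). -/
namespace Nat.Partition

open Finset Multiset

/-- Adding `s` copies of the part `i` identifies the partitions of `m` satisfying `Q` with the
partitions of `m + s * i` satisfying `P`. -/
theorem card_filter_eq_card_filter_of_add_replicate {m n s i : ℕ} (hi : 0 < i)
    (hn : m + s * i = n) (P Q : Multiset ℕ → Prop) [DecidablePred P] [DecidablePred Q]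
    (hPs : ∀ t, P t → s ≤ t.count i) (hPQ : ∀ t, P (t + replicate s i) ↔ Q t) :
    #{c : n.Partition | P c.parts} = #{c : m.Partition | Q c.parts} := by
  have hle {t : Multiset ℕ} (ht : P t) : replicate s i ≤ t :=
    le_count_iff_replicate_le.mp (hPs t ht)
  refine Finset.card_bij'
    (fun c hc ↦ ⟨c.parts - replicate s i,
      fun hj ↦ c.parts_pos (Multiset.mem_of_le (Multiset.sub_le_self _ _) hj), ?_⟩)
    (fun c _ ↦ ⟨c.parts + replicate s i, ?_, ?_⟩) ?_ ?_ ?_ ?_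
  · have h := congrArg Multiset.sum (tsub_add_cancel_of_le (hle (Finset.mem_filter.mp hc).2))
    rw [Multiset.sum_add, sum_replicate, smul_eq_mul, c.parts_sum] at h
    omega
  · intro j hj
    rcases Multiset.mem_add.mp hj with hj | hj
    · exact c.parts_pos hj
    · exact (eq_of_mem_replicate hj) ▸ hi
  · rw [Multiset.sum_add, sum_replicate, smul_eq_mul, c.parts_sum, hn]
  · intro c hc
    have hc := (Finset.mem_filter.mp hc).2
    simpa [← hPQ, tsub_add_cancel_of_le (hle hc)] using hc
  · intro c hc
    simpa [hPQ] using hc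
  · intro c hc
    ext1
    exact tsub_add_cancel_of_le (hle (Finset.mem_filter.mp hc).2)
  · intro c _
    ext1
    exact add_tsub_cancel_right _ _

/-- The sum of the numbers of distinct part values, counted by part value. -/
theorem sum_card_toFinset_parts {n : ℕ} (s : Finset n.Partition) :
    ∑ c ∈ s, #c.parts.toFinset = ∑ i ∈ Icc 1 n, #{c ∈ s | i ∈ c.parts} := by
  simp_rw [Finset.card_filter]
  rw [Finset.sum_comm]
  refine Finset.sum_congr rfl fun c _ ↦ ?_
  rw [← Finset.card_filter]
  congr 1
  ext i
  simp only [mem_toFinset, Finset.mem_filter, Finset.mem_Icc]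
  exact ⟨fun h ↦ ⟨⟨c.parts_pos h, le_of_mem_parts h⟩, h⟩, And.right⟩

/-- Each part value other than `i` occurs fewer than `k` times in `t`, and `i` occurs at least
`a` and fewer than `b` times. -/
def CountRestrictedExcept (k i a b : ℕ) (t : Multiset ℕ) : Prop :=
  (a ≤ t.count i ∧ t.count i < b) ∧ ∀ j ∈ t.toFinset, j ≠ i → t.count j < k

instance (k i a b : ℕ) : DecidablePred (CountRestrictedExcept k i a b) :=
  fun _ ↦ inferInstanceAs (Decidable (_ ∧ _))

theorem countRestrictedExcept_iff {k i a b : ℕ} (hk : 0 < k) {t : Multiset ℕ} :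
    CountRestrictedExcept k i a b t ↔
      (a ≤ t.count i ∧ t.count i < b) ∧ ∀ j, j ≠ i → t.count j < k := by
  refine and_congr_right fun _ ↦ ⟨fun h j hj ↦ ?_, fun h j _ ↦ h j⟩
  by_cases hjt : j ∈ t
  · exact h j (mem_toFinset.mpr hjt) hj
  · rwa [count_eq_zero_of_notMem hjt]

theorem forall_mem_count_lt_iff {k : ℕ} (hk : 0 < k) {t : Multiset ℕ} :
    (∀ j ∈ t, t.count j < k) ↔ ∀ j, t.count j < k := by
  refine ⟨fun h j ↦ ?_, fun h j _ ↦ h j⟩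
  by_cases hjt : j ∈ t
  · exact h j hjt
  · rwa [count_eq_zero_of_notMem hjt]

theorem card_countRestrictedExcept_add {k n i s : ℕ} (hk : 0 < k) (hi : 0 < i)
    (hs : s * i ≤ n) :
    #{c : n.Partition | CountRestrictedExcept k i s (s + k) c.parts} =
      #(countRestricted (n - s * i) k) := by
  refine card_filter_eq_card_filter_of_add_replicate hi (Nat.sub_add_cancel hs)
    (CountRestrictedExcept k i s (s + k)) (fun t ↦ ∀ j ∈ t, t.count j < k)
    (fun t ht ↦ ht.1.1) fun t ↦ ?_
  rw [countRestrictedExcept_iff hk, forall_mem_count_lt_iff hk]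
  constructor
  · rintro ⟨⟨-, h⟩, h'⟩ j
    rcases eq_or_ne j i with rfl | hj
    · simp at h
      omega
    · simpa [count_replicate, hj.symm] using h' j hj
  · intro h
    have hti := h i
    refine ⟨by simp; omega, fun j hj ↦ ?_⟩
    simpa [count_replicate, hj.symm] using h j

theorem card_countRestrictedExcept_eq_zero {k n i a b : ℕ} (ha : n < a * i) :
    #{c : n.Partition | CountRestrictedExcept k i a b c.parts} = 0 := by
  rw [Finset.card_eq_zero, Finset.filter_eq_empty_iff]
  rintro c - ⟨⟨h, -⟩, -⟩
  obtain ⟨u, hu⟩ := exists_add_of_le (le_count_iff_replicate_le.mp h)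
  have := congrArg Multiset.sum hu
  rw [Multiset.sum_add, sum_replicate, smul_eq_mul, c.parts_sum] at this
  omega

theorem card_countRestrictedExcept_split {k n i a b d : ℕ} (hab : a ≤ b) (hbd : b ≤ d) :
    #{c : n.Partition | CountRestrictedExcept k i a d c.parts} =
      #{c : n.Partition | CountRestrictedExcept k i a b c.parts} +
        #{c : n.Partition | CountRestrictedExcept k i b d c.parts} := by
  rw [← Finset.card_union_of_disjoint]
  · congr 1
    ext c
    simp only [CountRestrictedExcept, Finset.mem_union]
    grind
  · rw [Finset.disjoint_filter]
    rintro c - ⟨h, -⟩ ⟨h', -⟩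
    omega

theorem sum_card_countRestrictedExcept_mul {k n : ℕ} (hk : 0 < k) :
    ∑ i ∈ Icc 1 n, #{c : n.Partition | CountRestrictedExcept k i k (k + k) c.parts} =
      ∑ i ∈ Icc 1 n with k ∣ i, #(countRestricted (n - i) k) := by
  rw [← Finset.sum_filter_add_sum_filter_not _ (fun i ↦ k * i ≤ n),
    Finset.sum_eq_zero (s := {i ∈ Icc 1 n | ¬ k * i ≤ n}), add_zero]
  · refine Finset.sum_bij (fun i _ ↦ k * i) ?_ ?_ ?_ ?_
    · intro i hi
      simp only [Finset.mem_filter, Finset.mem_Icc] at hi ⊢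
      exact ⟨⟨Nat.mul_pos hk hi.1.1, hi.2⟩, dvd_mul_right k i⟩
    · intro i _ j _ h
      exact Nat.eq_of_mul_eq_mul_left hk h
    · intro j hj
      simp only [Finset.mem_filter, Finset.mem_Icc] at hj
      obtain ⟨⟨h1, h2⟩, i, rfl⟩ := hj
      exact ⟨i, by simp [h2, one_le_iff_ne_zero, right_ne_zero_of_mul (one_le_iff_ne_zero.mp h1),
        (Nat.le_mul_of_pos_left i hk).trans h2],
        rfl⟩
    · intro i hi
      simp only [Finset.mem_filter, Finset.mem_Icc] at hi
      exact card_countRestrictedExcept_add hk hi.1.1 hi.2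
  · intro i hi
    simp only [Finset.mem_filter, not_le] at hi
    exact card_countRestrictedExcept_eq_zero hi.2

theorem sum_card_toFinset_parts_restricted {k : ℕ} (n : ℕ) :
    ∑ c ∈ restricted n (¬ k ∣ ·), #c.parts.toFinset =
      ∑ i ∈ Icc 1 n with ¬ k ∣ i, #(restricted (n - i) (¬ k ∣ ·)) := by
  rw [sum_card_toFinset_parts, Finset.sum_filter]
  refine Finset.sum_congr rfl fun i hi ↦ ?_
  rw [Finset.mem_Icc] at hi
  rw [restricted, Finset.filter_filter]
  by_cases h : k ∣ i
  · rw [if_neg (not_not.mpr h), Finset.card_eq_zero, Finset.filter_eq_empty_iff]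
    exact fun c _ hc ↦ hc.1 i hc.2 h
  · rw [if_pos h]
    refine card_filter_eq_card_filter_of_add_replicate (s := 1) (m := n - i) hi.1 (by omega)
      (fun t ↦ (∀ j ∈ t, ¬ k ∣ j) ∧ i ∈ t) (fun t ↦ ∀ j ∈ t, ¬ k ∣ j)
      (fun t ht ↦ one_le_count_iff_mem.mpr ht.2) fun t ↦ ?_
    simp only [replicate_one, Multiset.mem_add, Multiset.mem_singleton]
    grind

theorem sum_card_toFinset_parts_countRestricted (k n : ℕ) :
    ∑ c ∈ countRestricted n k, #c.parts.toFinset =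
      ∑ i ∈ Icc 1 n, #{c : n.Partition | CountRestrictedExcept k i 1 k c.parts} := by
  rw [sum_card_toFinset_parts]
  refine Finset.sum_congr rfl fun i _ ↦ ?_
  rw [countRestricted, Finset.filter_filter]
  congr 1
  ext c
  simp only [Finset.mem_filter, Finset.mem_univ, true_and, CountRestrictedExcept,
    one_le_count_iff_mem, mem_toFinset]
  grind

theorem card_exists_countRestrictedExcept (k n : ℕ) :
    Nat.card {c : n.Partition // ∃ i, (k < c.parts.count i ∧ c.parts.count i < 2 * k) ∧
        ∀ j ∈ c.parts.toFinset, j ≠ i → c.parts.count j < k} =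
      ∑ i ∈ Icc 1 n,
        #{c : n.Partition | CountRestrictedExcept k i (k + 1) (k + k) c.parts} := by
  classical
  rw [Nat.card_eq_fintype_card, Fintype.card_subtype, ← Finset.card_biUnion]
  · congr 1
    ext c
    simp only [Finset.mem_filter, Finset.mem_univ, true_and, Finset.mem_biUnion, Finset.mem_Icc,
      CountRestrictedExcept, Nat.succ_le_iff, ← two_mul]
    refine exists_congr fun i ↦ ⟨fun h ↦ ⟨?_, h⟩, And.right⟩
    have hi : i ∈ c.parts := count_pos.mp (by omega)
    exact ⟨c.parts_pos hi, le_of_mem_parts hi⟩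
  · intro i _ j _ hij
    rw [Function.onFun, Finset.disjoint_filter]
    rintro c - ⟨h, -⟩ ⟨-, h'⟩
    have := h' i (mem_toFinset.mpr (count_pos.mp (by omega))) hij
    omega

end Nat.Partition


/-- For `k ≥ 1` and `n ≥ 0`, the number of partitions of `n` in which exactly one part value
occurs more than `k` times and fewer than `2k` times while every other part value occurs
fewer than `k` times equals the total number of distinct part values over all partitions of
`n` in which every part occurs fewer than `k` times, minus the total number of distinct part
values over all partitions of `n` with no part divisible by `k`. -/
theorem beck_conjecture_two_generalized (k n : ℕ) (hk : 1 ≤ k) :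
    (Nat.card {c : n.Partition // ∃ i,
        (k < c.parts.count i ∧ c.parts.count i < 2 * k) ∧
        ∀ j ∈ c.parts.toFinset, j ≠ i → c.parts.count j < k} : ℤ) =
      (∑ c ∈ Finset.univ.filter (fun c : n.Partition => ∀ i ∈ c.parts, c.parts.count i < k),
          (c.parts.toFinset.card : ℤ)) -
      (∑ c ∈ Finset.univ.filter (fun c : n.Partition => ∀ p ∈ c.parts, ¬ k ∣ p),
          (c.parts.toFinset.card : ℤ)) := by
  open Nat.Partition Finset in
  have hsplit : ∀ i ∈ Icc 1 n, #(countRestricted (n - i) k) +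
      #{c : n.Partition | CountRestrictedExcept k i (k + 1) (k + k) c.parts} =
      #{c : n.Partition | CountRestrictedExcept k i 1 k c.parts} +
        #{c : n.Partition | CountRestrictedExcept k i k (k + k) c.parts} := by
    intro i hi
    rw [Finset.mem_Icc] at hi
    have h₁ := card_countRestrictedExcept_add (s := 1) hk hi.1 (by simpa using hi.2)
    rw [one_mul, card_countRestrictedExcept_split (b := k) hk (by omega), add_comm 1 k] at h₁
    have h₂ := card_countRestrictedExcept_split (k := k) (n := n) (i := i) (a := k)
      (b := k + 1) (d := k + k) (by omega) (by omega)
    omega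
  have hsum := Finset.sum_congr rfl hsplit
  rw [Finset.sum_add_distrib, Finset.sum_add_distrib,
    ← Nat.Partition.sum_card_toFinset_parts_countRestricted,
    Nat.Partition.sum_card_countRestrictedExcept_mul hk,
    ← Nat.Partition.card_exists_countRestrictedExcept,
    ← Finset.sum_filter_add_sum_filter_not _ (fun i ↦ k ∣ i)] at hsum
  have hO := Nat.Partition.sum_card_toFinset_parts_restricted (k := k) n
  simp_rw [Nat.Partition.card_restricted_eq_card_countRestricted _ hk] at hO
  rw [← hO] at hsum
  rw [eq_sub_iff_add_eq, ← Nat.cast_sum, ← Nat.cast_sum, ← Nat.cast_add, Nat.cast_inj]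
  change _ + ∑ c ∈ Nat.Partition.restricted n (¬ k ∣ ·), c.parts.toFinset.card =
    ∑ c ∈ Nat.Partition.countRestricted n k, c.parts.toFinset.card
  omega
end

section
/- For every n ≥ 1, the number of partitions of n in which exactly one part value occurs exactly three times while all other part values occur exactly once equals the total number of parts counted over all partitions of n into distinct parts minus the total number of distinct part values counted over all partitions of n into odd parts. -/
namespace BeckConjecture

/-- The multisets of positive integers whose sum is the integer `z` (none if `z < 0`) and which
satisfy `p`. -/
def partsSet (p : Multiset ℕ → Prop) (z : ℤ) : Set (Multiset ℕ) :=
  {s | (∀ x ∈ s, 0 < x) ∧ (s.sum : ℤ) = z ∧ p s}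

/-- The number of partitions of the integer `z` whose multiset of parts satisfies `p`. -/
noncomputable def countParts (p : Multiset ℕ → Prop) (z : ℤ) : ℕ := (partsSet p z).ncard

lemma partsSet_natCast (p : Multiset ℕ → Prop) (n : ℕ) :
    partsSet p n = (Nat.Partition.parts (n := n)) '' {c | p c.parts} := by
  ext s
  simp only [partsSet, Set.mem_ofPred_eq, Set.mem_image, Nat.cast_inj]
  constructor
  · rintro ⟨h1, h2, h3⟩
    exact ⟨⟨s, fun {i} hi => h1 i hi, h2⟩, h3, rfl⟩
  · rintro ⟨c, hc, rfl⟩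
    exact ⟨fun x hx => c.parts_pos hx, c.parts_sum, hc⟩

lemma partsSet_of_neg (p : Multiset ℕ → Prop) {z : ℤ} (hz : z < 0) : partsSet p z = ∅ := by
  ext s
  simp only [partsSet, Set.mem_ofPred_eq, Set.mem_empty_iff_false, iff_false]
  rintro ⟨-, h, -⟩
  omega

lemma countParts_of_neg (p : Multiset ℕ → Prop) {z : ℤ} (hz : z < 0) : countParts p z = 0 := by
  simp [countParts, partsSet_of_neg p hz]

lemma finite_partsSet (p : Multiset ℕ → Prop) (z : ℤ) : (partsSet p z).Finite := by
  obtain hz | hz := lt_or_ge z 0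
  · simp [partsSet_of_neg p hz]
  · lift z to ℕ using hz
    rw [partsSet_natCast]
    exact (Set.toFinite _).image _

lemma card_eq_countParts {n : ℕ} (p : Multiset ℕ → Prop) (S : Finset n.Partition)
    (hS : ∀ c, c ∈ S ↔ p c.parts) : S.card = countParts p n := by
  rw [countParts, partsSet_natCast,
    Set.ncard_image_of_injective _ (fun a b h => Nat.Partition.ext h), ← Set.ncard_coe_finset]
  congr 1
  ext c
  simp [hS]

/-- Adjoining the parts `t` is a bijection from partitions satisfying `p` to those satisfying
`q`. -/
lemma countParts_add (p q : Multiset ℕ → Prop) (t : Multiset ℕ) (ht : ∀ x ∈ t, 0 < x)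
    (hpq : ∀ s, p s ↔ q (s + t)) (hq : ∀ s, q s → t ≤ s) (z : ℤ) :
    countParts q z = countParts p (z - t.sum) := by
  have : partsSet q z = (· + t) '' partsSet p (z - t.sum) := by
    ext s
    simp only [partsSet, Set.mem_ofPred_eq, Set.mem_image]
    constructor
    · rintro ⟨h1, h2, h3⟩
      obtain ⟨u, rfl⟩ := Multiset.le_iff_exists_add.1 (hq s h3)
      rw [add_comm t u] at *
      refine ⟨u, ⟨fun x hx => h1 x (by simp [hx]), ?_, (hpq u).2 h3⟩, rfl⟩
      simp only [Multiset.sum_add, Nat.cast_add] at h2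
      omega
    · rintro ⟨u, ⟨h1, h2, h3⟩, rfl⟩
      refine ⟨fun x hx => ?_, ?_, (hpq u).1 h3⟩
      · rcases Multiset.mem_add.1 hx with h | h
        exacts [h1 x h, ht x h]
      · simp only [Multiset.sum_add, Nat.cast_add]
        omega
  rw [countParts, this, Set.ncard_image_of_injective _ (add_left_injective t), countParts]

lemma countParts_and_add_and_not (p q : Multiset ℕ → Prop) (z : ℤ) :
    countParts p z = countParts (fun s => p s ∧ q s) z + countParts (fun s => p s ∧ ¬ q s) z := by
  rw [countParts, countParts, countParts, ← Set.ncard_union_eq ?_ (finite_partsSet _ _)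
    (finite_partsSet _ _)]
  · congr 1
    ext s
    simp only [partsSet, Set.mem_ofPred_eq, Set.mem_union]
    tauto
  · rw [Set.disjoint_left]
    rintro s ⟨-, -, -, h⟩ ⟨-, -, -, h'⟩
    exact h' h

/-- `i` occurs exactly three times and every other part exactly once. -/
def TripleAt (i : ℕ) (s : Multiset ℕ) : Prop :=
  s.count i = 3 ∧ ∀ j ∈ s.toFinset, j ≠ i → s.count j = 1

lemma countParts_nodup_mem {i : ℕ} (hi : 0 < i) (z : ℤ) :
    countParts (fun s => s.Nodup ∧ i ∈ s) z = countParts (fun s => s.Nodup ∧ i ∉ s) (z - i) := by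
  rw [countParts_add (fun s => s.Nodup ∧ i ∉ s) _ {i} (by simpa using hi)]
  · simp
  · intro s
    rw [add_comm, Multiset.singleton_add]
    simp [and_comm]
  · rintro s ⟨-, h⟩
    simpa using h

lemma countParts_tripleAt {i : ℕ} (hi : 0 < i) (z : ℤ) :
    countParts (TripleAt i) z = countParts (fun s => s.Nodup ∧ i ∉ s) (z - 3 * i) := by
  rw [countParts_add (fun s => s.Nodup ∧ i ∉ s) _ (Multiset.replicate 3 i)]
  · simp [Multiset.sum_replicate, -Multiset.replicate_succ]
  · intro x hx
    rwa [Multiset.eq_of_mem_replicate hx]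
  · intro s
    simp only [TripleAt, Multiset.count_add, Multiset.count_replicate, Multiset.mem_toFinset,
      Multiset.mem_add, Multiset.nodup_iff_count_le_one, ← Multiset.count_eq_zero]
    constructor
    · rintro ⟨h1, h2⟩
      refine ⟨by simp [h2], fun j hj hji => ?_⟩
      have : j ∈ s := by
        rcases hj with h | h
        exacts [h, absurd (Multiset.eq_of_mem_replicate h) hji]
      have := Multiset.count_pos.2 this
      have := h1 j
      simp only [hji.symm, if_false]
      omega
    · rintro ⟨h1, h2⟩
      have hi0 : s.count i = 0 := by simpa using h1
      refine ⟨fun j => ?_, hi0⟩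
      by_cases hji : j = i
      · subst hji; omega
      · by_cases hj : j ∈ s
        · have := h2 j (Or.inl hj) hji
          omega
        · simp [Multiset.count_eq_zero.2 hj]
  · rintro s ⟨h, -⟩
    rw [← Multiset.le_count_iff_replicate_le, h]

lemma countParts_odd_mem {i : ℕ} (hi : Odd i) (z : ℤ) :
    countParts (fun s => (∀ x ∈ s, Odd x) ∧ i ∈ s) z =
      countParts (fun s => ∀ x ∈ s, Odd x) (z - i) := by
  rw [countParts_add (fun s => ∀ x ∈ s, Odd x) _ {i} (by simpa using hi.pos)]
  · simp
  · intro s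
    rw [add_comm, Multiset.singleton_add]
    simp [hi]
  · rintro s ⟨-, h⟩
    simpa using h

lemma countParts_nodup_mem_sub_tripleAt {i : ℕ} (hi : 0 < i) (z : ℤ) :
    (countParts (fun s => s.Nodup ∧ i ∈ s) z : ℤ) - countParts (TripleAt i) z =
      countParts Multiset.Nodup (z - i) - countParts Multiset.Nodup (z - 2 * i) := by
  have h1 := countParts_and_add_and_not Multiset.Nodup (i ∈ ·) (z - i)
  have h2 := countParts_and_add_and_not Multiset.Nodup (i ∈ ·) (z - 2 * i)
  have h3 := countParts_nodup_mem hi (z - i)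
  have h4 := countParts_nodup_mem hi (z - 2 * i)
  rw [show z - i - i = z - 2 * i by ring] at h3
  rw [show z - 2 * i - i = z - 3 * i by ring] at h4
  rw [countParts_nodup_mem hi z, countParts_tripleAt hi z]
  omega

lemma countParts_odd_eq_nodup (z : ℤ) :
    countParts (fun s => ∀ x ∈ s, Odd x) z = countParts Multiset.Nodup z := by
  obtain hz | hz := lt_or_ge z 0
  · simp [countParts_of_neg _ hz]
  · lift z to ℕ using hz
    rw [← card_eq_countParts _ (Nat.Partition.odds z), ← card_eq_countParts _
      (Nat.Partition.distincts z), Nat.Partition.card_odds_eq_card_distincts]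
    · simp [Nat.Partition.distincts]
    · simp [Nat.Partition.odds, Nat.Partition.restricted]

lemma mem_Icc_of_mem_parts {n i : ℕ} {c : n.Partition} (hi : i ∈ c.parts) :
    i ∈ Finset.Icc 1 n := by
  rw [Finset.mem_Icc]
  exact ⟨c.parts_pos hi, c.parts_sum ▸ Multiset.le_sum_of_mem hi⟩

/-- Double counting of pairs of a partition and one of its part values. -/
lemma sum_card_toFinset {n : ℕ} (p : Multiset ℕ → Prop) (S : Finset n.Partition)
    (hS : ∀ c, c ∈ S ↔ p c.parts) :
    ∑ c ∈ S, c.parts.toFinset.card =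
      ∑ i ∈ Finset.Icc 1 n, countParts (fun s => p s ∧ i ∈ s) n := by
  calc ∑ c ∈ S, c.parts.toFinset.card
      = ∑ c ∈ S, ((Finset.Icc 1 n).filter (· ∈ c.parts)).card := by
        refine Finset.sum_congr rfl fun c _ => congrArg _ ?_
        ext i
        simpa using fun h => Finset.mem_Icc.1 (mem_Icc_of_mem_parts h)
    _ = ∑ i ∈ Finset.Icc 1 n, (S.filter (i ∈ ·.parts)).card :=
        Finset.sum_card_bipartiteAbove_eq_sum_card_bipartiteBelow _
    _ = _ := Finset.sum_congr rfl fun i _ => card_eq_countParts _ _ fun c => by simp [hS]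

lemma card_exists_tripleAt (n : ℕ) :
    Nat.card {c : n.Partition // ∃ i, TripleAt i c.parts} =
      ∑ i ∈ Finset.Icc 1 n, countParts (TripleAt i) n := by
  classical
  rw [Nat.card_eq_fintype_card, Fintype.card_subtype]
  have hU : (Finset.univ.filter fun c : n.Partition => ∃ i, TripleAt i c.parts) =
      (Finset.Icc 1 n).biUnion fun i => Finset.univ.filter fun c => TripleAt i c.parts := by
    ext c
    simp only [Finset.mem_filter, Finset.mem_univ, true_and, Finset.mem_biUnion]
    refine ⟨?_, fun ⟨i, _, h⟩ => ⟨i, h⟩⟩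
    rintro ⟨i, h⟩
    exact ⟨i, mem_Icc_of_mem_parts (Multiset.count_pos.1 (by rw [h.1]; norm_num)), h⟩
  rw [hU, Finset.card_biUnion]
  · exact Finset.sum_congr rfl fun i _ => card_eq_countParts _ _ fun c => by simp
  · intro i _ j _ hij
    rw [Function.onFun, Finset.disjoint_left]
    intro c hc hc'
    simp only [Finset.mem_filter, Finset.mem_univ, true_and] at hc hc'
    have hj : j ∈ c.parts.toFinset :=
      Multiset.mem_toFinset.2 (Multiset.count_pos.1 (by rw [hc'.1]; norm_num))
    have := hc.2 j hj hij.symm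
    rw [hc'.1] at this
    norm_num at this

lemma sum_Icc_two_mul (n : ℕ) (f : ℕ → ℤ) (hf : ∀ i, n < i → f i = 0) :
    ∑ i ∈ Finset.Icc 1 n, f (2 * i) = ∑ i ∈ Finset.Icc 1 n with ¬ Odd i, f i := by
  symm
  refine Finset.sum_bij_ne_zero (fun i _ _ => i / 2) ?_ ?_ ?_ ?_
  · intro i hi _
    simp only [Finset.mem_filter, Finset.mem_Icc, Nat.not_odd_iff] at hi ⊢
    omega
  · intro i hi _ j hj _ h
    simp only [Finset.mem_filter, Nat.not_odd_iff] at hi hj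
    omega
  · intro i hi h
    have : ¬ n < 2 * i := fun h' => h (hf _ h')
    refine ⟨2 * i, ?_, h, by omega⟩
    simp only [Finset.mem_filter, Finset.mem_Icc, Nat.not_odd_iff] at hi ⊢
    omega
  · intro i hi _
    simp only [Finset.mem_filter, Nat.not_odd_iff] at hi
    rw [show 2 * (i / 2) = i by omega]

lemma sum_card_odds (n : ℕ) :
    ∑ c ∈ Nat.Partition.odds n, c.parts.toFinset.card =
      ∑ i ∈ Finset.Icc 1 n with Odd i, countParts Multiset.Nodup ((n : ℤ) - i) := by
  rw [sum_card_toFinset (fun s => ∀ x ∈ s, Odd x) _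
    (by simp [Nat.Partition.odds, Nat.Partition.restricted]), Finset.sum_filter]
  refine Finset.sum_congr rfl fun i _ => ?_
  split_ifs with hi
  · rw [countParts_odd_mem hi, countParts_odd_eq_nodup]
  · have : partsSet (fun s => (∀ x ∈ s, Odd x) ∧ i ∈ s) n = ∅ :=
      Set.eq_empty_of_forall_notMem fun s hs => hi (hs.2.2.1 i hs.2.2.2)
    simp [countParts, this]

lemma sum_card_distincts (n : ℕ) :
    ∑ c ∈ Nat.Partition.distincts n, Multiset.card c.parts =
      ∑ i ∈ Finset.Icc 1 n, countParts (fun s => s.Nodup ∧ i ∈ s) n := by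
  have hS : ∀ c, c ∈ Nat.Partition.distincts n ↔ c.parts.Nodup := by
    simp [Nat.Partition.distincts]
  rw [← sum_card_toFinset _ _ hS]
  exact Finset.sum_congr rfl fun c hc =>
    (Multiset.toFinset_card_of_nodup ((hS c).1 hc)).symm

end BeckConjecture

open BeckConjecture in

/-- For `n ≥ 1`, the number of partitions of `n` in which exactly one part value occurs
exactly three times while all other part values occur exactly once equals the total number of
parts over all distinct partitions of `n` minus the total number of distinct part values over
all odd partitions of `n`. -/
theorem beck_conjecture_two (n : ℕ) (hn : 1 ≤ n) :
    (Nat.card {c : n.Partition // ∃ i, c.parts.count i = 3 ∧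
        ∀ j ∈ c.parts.toFinset, j ≠ i → c.parts.count j = 1} : ℤ) =
      (∑ c ∈ Nat.Partition.distincts n, (Multiset.card c.parts : ℤ)) -
      (∑ c ∈ Nat.Partition.odds n, (c.parts.toFinset.card : ℤ)) := by
  have hT := card_exists_tripleAt n
  unfold TripleAt at hT
  rw [hT, ← Nat.cast_sum, ← Nat.cast_sum, sum_card_distincts, sum_card_odds]
  push_cast
  rw [eq_sub_iff_add_eq', ← eq_sub_iff_add_eq, ← Finset.sum_sub_distrib]
  have key := fun i (hi : i ∈ Finset.Icc 1 n) =>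
    countParts_nodup_mem_sub_tripleAt (Finset.mem_Icc.1 hi).1 n
  unfold TripleAt at key
  rw [Finset.sum_congr rfl key, Finset.sum_sub_distrib, eq_sub_iff_add_eq]
  have h2 := sum_Icc_two_mul n (fun i => (countParts Multiset.Nodup ((n : ℤ) - i) : ℤ))
    fun i hi => by simp [countParts_of_neg _ (show (n : ℤ) - i < 0 by omega)]
  push_cast at h2
  rw [h2]
  exact Finset.sum_filter_add_sum_filter_not _ _ _
end

section
/- For every n ≥ 1, the number of gap-free partitions of n equals the sum of the smallest parts over all partitions of n into distinct parts having an odd number of parts. -/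
/-- A multiset of parts is gap-free if the part values form a set of consecutive integers,
i.e. every integer lying between two parts is itself a part.  For a partition written as a
nonincreasing sequence this says consecutive parts differ by at most 1. -/
def GapFree (μ : Multiset ℕ) : Prop :=
  ∀ p ∈ μ, ∀ q ∈ μ, ∀ r, p ≤ r → r ≤ q → r ∈ μ

open Finset

/-- The finite set of multisets of positive integers with sum `n`. -/
def partsFinset (n : ℕ) : Finset (Multiset ℕ) :=
  (univ : Finset n.Partition).image Nat.Partition.parts

theorem mem_partsFinset {n : ℕ} {μ : Multiset ℕ} :
    μ ∈ partsFinset n ↔ (∀ x ∈ μ, 0 < x) ∧ μ.sum = n := by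
  simp only [partsFinset, mem_image, mem_univ, true_and]
  constructor
  · rintro ⟨c, rfl⟩
    exact ⟨fun x hx => c.parts_pos hx, c.parts_sum⟩
  · rintro ⟨h, hs⟩
    exact ⟨⟨μ, fun {i} hi => h i hi, hs⟩, rfl⟩

theorem card_le_of_mem_partsFinset {n : ℕ} {μ : Multiset ℕ} (h : μ ∈ partsFinset n) :
    Multiset.card μ ≤ n := by
  rw [mem_partsFinset] at h
  have := Multiset.card_nsmul_le_sum (s := μ) (a := 1) h.1
  simpa [h.2] using this

/-- The multisets of `r` distinct positive integers with sum `n`. -/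
def distinctParts (r n : ℕ) : Finset (Multiset ℕ) :=
  (partsFinset n).filter fun μ => μ.Nodup ∧ Multiset.card μ = r

/-- The partitions of `n` whose set of part sizes is `{1, …, r}`. -/
def fullParts (r n : ℕ) : Finset (Multiset ℕ) :=
  (partsFinset n).filter fun μ => μ.toFinset = Icc 1 r

/-- All parts lie in `[a, a + r]` and every integer of `[a, a + r)` is a part. -/
def SpansFrom (r a : ℕ) (μ : Multiset ℕ) : Prop :=
  (∀ x ∈ μ, a ≤ x ∧ x ≤ a + r) ∧ ∀ x, a ≤ x → x < a + r → x ∈ μ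

open Classical in
/-- The gap-free partitions of `n` with `r` or `r + 1` distinct part sizes. -/
noncomputable def gapFreeParts (r n : ℕ) : Finset (Multiset ℕ) :=
  (partsFinset n).filter fun μ => ∃ a, SpansFrom r a μ

open Classical in
theorem mem_gapFreeParts {r n : ℕ} {μ : Multiset ℕ} :
    μ ∈ gapFreeParts r n ↔ μ ∈ partsFinset n ∧ ∃ a, SpansFrom r a μ := by
  rw [gapFreeParts, mem_filter]

theorem sInf_parts_eq {μ : Multiset ℕ} {a : ℕ} (ha : a ∈ μ) (h : ∀ x ∈ μ, a ≤ x) :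
    sInf {p | p ∈ μ} = a :=
  IsLeast.csInf_eq ⟨ha, h⟩

theorem SpansFrom.sInf_eq {r a : ℕ} {μ : Multiset ℕ} (hr : 0 < r) (h : SpansFrom r a μ) :
    sInf {p | p ∈ μ} = a :=
  sInf_parts_eq (h.2 a le_rfl (by omega)) fun x hx => (h.1 x hx).1

theorem SpansFrom.card_toFinset {r a : ℕ} {μ : Multiset ℕ} (h : SpansFrom r a μ) :
    r ≤ #μ.toFinset ∧ #μ.toFinset ≤ r + 1 := by
  constructor
  · have : Ico a (a + r) ⊆ μ.toFinset := fun x hx => by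
      rw [mem_Ico] at hx
      exact Multiset.mem_toFinset.2 (h.2 x hx.1 hx.2)
    simpa using card_le_card this
  · have : μ.toFinset ⊆ Icc a (a + r) := fun x hx => by
      rw [Multiset.mem_toFinset] at hx
      exact mem_Icc.2 (h.1 x hx)
    have := card_le_card this
    rw [Nat.card_Icc] at this
    omega

theorem distinctParts_eq_empty {r n : ℕ} (h : n < r) : distinctParts r n = ∅ := by
  refine filter_eq_empty_iff.2 fun μ hμ hc => ?_
  have := card_le_of_mem_partsFinset hμ
  omega

theorem gapFreeParts_eq_empty {r n : ℕ} (h : n < r) : gapFreeParts r n = ∅ := by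
  refine eq_empty_of_forall_notMem fun μ h => ?_
  obtain ⟨hμ, a, ha⟩ := mem_gapFreeParts.1 h
  have := card_le_of_mem_partsFinset hμ
  have := ha.card_toFinset.1
  have := μ.toFinset_card_le
  omega

theorem fullParts_eq_empty {r n : ℕ} (h : n < r) : fullParts r n = ∅ := by
  refine filter_eq_empty_iff.2 fun μ hμ hc => ?_
  have := card_le_of_mem_partsFinset hμ
  have := μ.toFinset_card_le
  rw [hc, Nat.card_Icc] at this
  omega

theorem sum_map_succ (μ : Multiset ℕ) : (μ.map Nat.succ).sum = μ.sum + Multiset.card μ := by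
  simp [Nat.succ_eq_add_one, Multiset.sum_map_add]

theorem exists_map_succ {μ : Multiset ℕ} (h : ∀ x ∈ μ, 0 < x) :
    ∃ ν : Multiset ℕ, μ = ν.map Nat.succ := by
  refine ⟨μ.map Nat.pred, ?_⟩
  rw [Multiset.map_map]
  conv_lhs => rw [← Multiset.map_id μ]
  exact Multiset.map_congr rfl fun x hx => (Nat.succ_pred_eq_of_pos (h x hx)).symm

theorem distinctParts_add (r m : ℕ) :
    distinctParts (r + 1) (m + (r + 1)) =
      (distinctParts (r + 1) m).image (Multiset.map Nat.succ) ∪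
        (distinctParts r m).image fun μ => 1 ::ₘ μ.map Nat.succ := by
  have hinj := Nat.succ_injective
  ext μ
  simp only [distinctParts, mem_union, mem_image, mem_filter, mem_partsFinset]
  constructor
  · rintro ⟨⟨hpos, hsum⟩, hnd, hc⟩
    by_cases h1 : 1 ∈ μ
    · obtain ⟨ν, rfl⟩ := Multiset.exists_cons_of_mem h1
      rw [Multiset.nodup_cons] at hnd
      obtain ⟨ρ, rfl⟩ := exists_map_succ fun x hx => hpos x (Multiset.mem_cons_of_mem hx)
      rw [Multiset.sum_cons, sum_map_succ] at hsum
      rw [Multiset.card_cons, Multiset.card_map] at hc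
      refine Or.inr ⟨ρ, ⟨⟨fun x hx => ?_, by omega⟩, hnd.2.of_map, by omega⟩, rfl⟩
      rcases Nat.eq_zero_or_pos x with rfl | h
      · exact absurd (Multiset.mem_map_of_mem _ hx) hnd.1
      · exact h
    · obtain ⟨ρ, rfl⟩ := exists_map_succ hpos
      rw [sum_map_succ] at hsum
      rw [Multiset.card_map] at hc
      refine Or.inl ⟨ρ, ⟨⟨fun x hx => ?_, by omega⟩, hnd.of_map, hc⟩, rfl⟩
      rcases Nat.eq_zero_or_pos x with rfl | h
      · exact absurd (Multiset.mem_map_of_mem _ hx) h1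
      · exact h
  · rintro (⟨ρ, ⟨⟨hpos, hsum⟩, hnd, hc⟩, rfl⟩ | ⟨ρ, ⟨⟨hpos, hsum⟩, hnd, hc⟩, rfl⟩)
    · refine ⟨⟨by simp, by rw [sum_map_succ]; omega⟩, hnd.map hinj, by simpa using hc⟩
    · refine ⟨⟨by simp, by rw [Multiset.sum_cons, sum_map_succ]; omega⟩, ?_, by simpa using hc⟩
      refine Multiset.nodup_cons.2 ⟨fun h => ?_, hnd.map hinj⟩
      obtain ⟨x, hx, hx1⟩ := Multiset.mem_map.1 h
      have := hpos x hx
      omega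

theorem sum_distinctParts_add (f : Multiset ℕ → ℕ) (r m : ℕ) :
    ∑ μ ∈ distinctParts (r + 1) (m + (r + 1)), f μ =
      ∑ μ ∈ distinctParts (r + 1) m, f (μ.map Nat.succ) +
        ∑ μ ∈ distinctParts r m, f (1 ::ₘ μ.map Nat.succ) := by
  have hinj := Multiset.map_injective Nat.succ_injective
  rw [distinctParts_add, sum_union, sum_image fun _ _ _ _ h => hinj h,
    sum_image fun _ _ _ _ h => hinj ((Multiset.cons_inj_right 1).1 h)]
  rw [disjoint_left]
  intro μ h1 h2
  obtain ⟨ρ, hρ, rfl⟩ := mem_image.1 h1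
  obtain ⟨σ, hσ, h⟩ := mem_image.1 h2
  have : 1 ∈ ρ.map Nat.succ := h ▸ Multiset.mem_cons_self _ _
  obtain ⟨x, hx, hx1⟩ := Multiset.mem_map.1 this
  have := (mem_partsFinset.1 (mem_filter.1 hρ).1).1 x hx
  omega

theorem card_distinctParts_add (r m : ℕ) :
    #(distinctParts (r + 1) (m + (r + 1))) =
      #(distinctParts (r + 1) m) + #(distinctParts r m) := by
  simpa using sum_distinctParts_add (fun _ => 1) r m

theorem sum_sInf_distinctParts_add (r m : ℕ) :
    ∑ μ ∈ distinctParts (r + 1) (m + (r + 1)), sInf {p | p ∈ μ} =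
      ∑ μ ∈ distinctParts (r + 1) m, sInf {p | p ∈ μ} +
        #(distinctParts (r + 1) (m + (r + 1))) := by
  rw [sum_distinctParts_add, card_distinctParts_add, ← add_assoc, card_eq_sum_ones,
    card_eq_sum_ones, ← sum_add_distrib]
  congr 1
  · refine sum_congr rfl fun μ hμ => ?_
    have hc := (mem_filter.1 hμ).2.2
    have hne : {p | p ∈ μ}.Nonempty := Multiset.card_pos_iff_exists_mem.1 (by omega)
    refine sInf_parts_eq (Multiset.mem_map_of_mem _ (Nat.sInf_mem hne)) fun x hx => ?_
    obtain ⟨y, hy, rfl⟩ := Multiset.mem_map.1 hx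
    exact Nat.succ_le_succ (Nat.sInf_le hy)
  · refine sum_congr rfl fun μ _ => sInf_parts_eq (Multiset.mem_cons_self _ _) fun x hx => ?_
    rcases Multiset.mem_cons.1 hx with rfl | hx
    · rfl
    · obtain ⟨y, _, rfl⟩ := Multiset.mem_map.1 hx
      omega

theorem fullParts_add (r m : ℕ) :
    fullParts (r + 1) (m + (r + 1)) =
      (fullParts (r + 1) m ∪ fullParts r m).image (Multiset.cons (r + 1)) := by
  ext μ
  simp only [fullParts, mem_image, mem_union, mem_filter, mem_partsFinset, Finset.ext_iff,
    Multiset.mem_toFinset, mem_Icc]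
  constructor
  · rintro ⟨⟨hpos, hsum⟩, hset⟩
    obtain ⟨ν, rfl⟩ := Multiset.exists_cons_of_mem ((hset (r + 1)).2 (by omega))
    rw [Multiset.sum_cons] at hsum
    have hpos' : ∀ x ∈ ν, 0 < x := fun x hx => hpos x (Multiset.mem_cons_of_mem hx)
    simp only [Multiset.mem_cons] at hset
    refine ⟨ν, ?_, rfl⟩
    by_cases h : r + 1 ∈ ν
    · refine Or.inl ⟨⟨hpos', by omega⟩, fun x => ?_⟩
      grind
    · refine Or.inr ⟨⟨hpos', by omega⟩, fun x => ?_⟩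
      grind
  · rintro ⟨ν, ⟨⟨hpos, hsum⟩, hset⟩ | ⟨⟨hpos, hsum⟩, hset⟩, rfl⟩ <;>
    · simp only [Multiset.mem_cons, Multiset.sum_cons]
      refine ⟨⟨?_, by omega⟩, fun x => ?_⟩ <;> grind

theorem card_fullParts_add (r m : ℕ) :
    #(fullParts (r + 1) (m + (r + 1))) = #(fullParts (r + 1) m) + #(fullParts r m) := by
  rw [fullParts_add, card_image_of_injective _ fun _ _ h => (Multiset.cons_inj_right (r + 1)).1 h,
    card_union_of_disjoint]
  rw [disjoint_left]
  intro μ h1 h2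
  have h := (mem_filter.1 h1).2.symm.trans (mem_filter.1 h2).2
  have := congrArg card h
  simp at this

theorem card_distinctParts_eq_card_fullParts (r n : ℕ) :
    #(distinctParts r n) = #(fullParts r n) := by
  induction n using Nat.strong_induction_on generalizing r with
  | _ n ih =>
    cases r with
    | zero =>
      rw [distinctParts, fullParts]
      congr 1
      refine filter_congr fun μ _ => ?_
      simp +contextual
    | succ r =>
      rcases lt_or_ge n (r + 1) with h | h
      · rw [distinctParts_eq_empty h, fullParts_eq_empty h]
      · obtain ⟨m, rfl⟩ := Nat.exists_eq_add_of_le' h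
        rw [card_distinctParts_add, card_fullParts_add, ih m (by omega), ih m (by omega)]

theorem fullParts_subset_gapFreeParts (r n : ℕ) : fullParts r n ⊆ gapFreeParts r n := by
  intro μ hμ
  simp only [fullParts, mem_gapFreeParts, mem_filter, Finset.ext_iff, Multiset.mem_toFinset,
    mem_Icc] at hμ ⊢
  refine ⟨hμ.1, 1, fun x hx => ?_, fun x h1 h2 => ?_⟩
  · have := (hμ.2 x).1 hx
    omega
  · exact (hμ.2 x).2 (by omega)

/-- Enlarge one smallest part by `r`. -/
noncomputable def raiseSmallest (r : ℕ) (μ : Multiset ℕ) : Multiset ℕ :=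
  (sInf {p | p ∈ μ} + r) ::ₘ μ.erase (sInf {p | p ∈ μ})

theorem raiseSmallest_cons {r a : ℕ} {ν : Multiset ℕ} (h : ∀ x ∈ ν, a ≤ x) :
    raiseSmallest r (a ::ₘ ν) = (a + r) ::ₘ ν := by
  have : sInf {p | p ∈ a ::ₘ ν} = a :=
    sInf_parts_eq (Multiset.mem_cons_self _ _) (by simpa using h)
  rw [raiseSmallest, this, Multiset.erase_cons_head]

theorem SpansFrom.exists_cons {r a : ℕ} {μ : Multiset ℕ} (hr : 0 < r) (h : SpansFrom r a μ) :
    ∃ ν, μ = a ::ₘ ν ∧ raiseSmallest r μ = (a + r) ::ₘ ν := by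
  obtain ⟨ν, rfl⟩ := Multiset.exists_cons_of_mem (h.2 a le_rfl (by omega))
  exact ⟨ν, rfl, raiseSmallest_cons fun x hx => (h.1 x (Multiset.mem_cons_of_mem hx)).1⟩

theorem card_gapFreeParts_sdiff {r : ℕ} (hr : 0 < r) (m : ℕ) :
    #(gapFreeParts r (m + r) \ fullParts r (m + r)) = #(gapFreeParts r m) := by
  symm
  refine card_bij (fun μ _ => raiseSmallest r μ) ?_ ?_ ?_
  · intro μ hμ
    obtain ⟨hμ, a, ha⟩ := mem_gapFreeParts.1 hμ
    obtain ⟨ν, rfl, hν⟩ := ha.exists_cons hr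
    rw [hν]
    rw [mem_partsFinset, Multiset.sum_cons] at hμ
    obtain ⟨h1, h2⟩ := ha
    simp only [Multiset.mem_cons] at hμ h1 h2
    simp only [mem_gapFreeParts, fullParts, mem_sdiff, mem_filter, mem_partsFinset, Finset.ext_iff,
      Multiset.mem_toFinset, mem_Icc, SpansFrom, Multiset.mem_cons, Multiset.sum_cons]
    refine ⟨⟨⟨by grind, by omega⟩, ?_⟩, ?_⟩
    · by_cases haν : a ∈ ν
      · exact ⟨a, by grind, by grind⟩
      · exact ⟨a + 1, by grind, by grind⟩
    · rintro ⟨-, h⟩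
      have := (h (a + r)).1 (Or.inl rfl)
      have := hμ.1 a (Or.inl rfl)
      omega
  · intro μ hμ μ' hμ' heq
    obtain ⟨-, a, ha⟩ := mem_gapFreeParts.1 hμ
    obtain ⟨-, b, hb⟩ := mem_gapFreeParts.1 hμ'
    obtain ⟨ν, rfl, hν⟩ := ha.exists_cons hr
    obtain ⟨ν', rfl, hν'⟩ := hb.exists_cons hr
    simp only [hν, hν'] at heq
    have h1 : a + r ∈ (b + r) ::ₘ ν' := heq ▸ Multiset.mem_cons_self _ _
    have h2 : b + r ∈ (a + r) ::ₘ ν := heq ▸ Multiset.mem_cons_self _ _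
    have hab : a = b := by
      have ha1 := ha.1
      have hb1 := hb.1
      simp only [Multiset.mem_cons] at h1 h2 ha1 hb1
      grind
    subst hab
    rw [(Multiset.cons_inj_right _).1 heq]
  · intro μ hμ
    obtain ⟨hμ, hfull⟩ := mem_sdiff.1 hμ
    obtain ⟨hp, a, h1, h2⟩ := mem_gapFreeParts.1 hμ
    have hnot : μ.toFinset ≠ Icc 1 r := fun h => hfull (mem_filter.2 ⟨hp, h⟩)
    rw [mem_partsFinset] at hp
    suffices ∃ b ν, 0 < b ∧ μ = (b + r) ::ₘ ν ∧ SpansFrom r b (b ::ₘ ν) by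
      obtain ⟨b, ν, hb, rfl, hs⟩ := this
      refine ⟨b ::ₘ ν, mem_gapFreeParts.2 ⟨mem_partsFinset.2 ⟨?_, ?_⟩, b, hs⟩, ?_⟩
      · simp only [Multiset.mem_cons] at hp ⊢
        grind
      · simp only [Multiset.sum_cons] at hp ⊢
        omega
      · exact raiseSmallest_cons fun x hx => (hs.1 x (Multiset.mem_cons_of_mem hx)).1
    have ha : 0 < a := hp.1 a (h2 a le_rfl (by omega))
    by_cases har : a + r ∈ μ
    · obtain ⟨ν, rfl⟩ := Multiset.exists_cons_of_mem har
      simp only [Multiset.mem_cons] at h1 h2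
      refine ⟨a, ν, ha, rfl, ?_, ?_⟩ <;> simp only [Multiset.mem_cons] <;> grind
    · obtain ⟨b, rfl⟩ := Nat.exists_eq_add_of_lt ha
      rw [zero_add] at *
      have hb : 0 < b := by
        by_contra hb
        obtain rfl : b = 0 := by omega
        refine hnot ?_
        ext x
        rw [Multiset.mem_toFinset, mem_Icc]
        grind
      obtain ⟨ν, rfl⟩ := Multiset.exists_cons_of_mem (h2 (b + r) (by omega) (by omega))
      simp only [Multiset.mem_cons] at h1 h2 har
      refine ⟨b, ν, hb, rfl, ?_, ?_⟩ <;> simp only [Multiset.mem_cons] <;> grind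

theorem card_gapFreeParts_add {r : ℕ} (hr : 0 < r) (m : ℕ) :
    #(gapFreeParts r (m + r)) = #(gapFreeParts r m) + #(fullParts r (m + r)) := by
  rw [← card_gapFreeParts_sdiff hr m,
    card_sdiff_add_card_eq_card (fullParts_subset_gapFreeParts r _)]

/-- The smallest parts of the partitions of `n` into `r` distinct parts sum to the number of
gap-free partitions of `n` with `r` or `r + 1` distinct part sizes. -/
theorem card_gapFreeParts_eq_sum {r : ℕ} (hr : 0 < r) (n : ℕ) :
    #(gapFreeParts r n) = ∑ μ ∈ distinctParts r n, sInf {p | p ∈ μ} := by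
  induction n using Nat.strong_induction_on with
  | _ n ih =>
    rcases lt_or_ge n r with h | h
    · rw [distinctParts_eq_empty h, gapFreeParts_eq_empty h, sum_empty, card_empty]
    · obtain ⟨m, rfl⟩ := Nat.exists_eq_add_of_le' h
      rw [card_gapFreeParts_add hr, ih m (by omega), ← card_distinctParts_eq_card_fullParts]
      obtain ⟨k, rfl⟩ := Nat.exists_eq_succ_of_ne_zero hr.ne'
      exact (sum_sInf_distinctParts_add k m).symm

theorem SpansFrom.gapFree {r a : ℕ} {μ : Multiset ℕ} (h : SpansFrom r a μ) : GapFree μ := by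
  intro p hp q hq x hpx hxq
  have h1 := h.1 p hp
  have h2 := h.1 q hq
  rcases lt_or_ge x (a + r) with hx | hx
  · exact h.2 x (by omega) hx
  · rwa [show x = q by omega]

theorem GapFree.exists_spansFrom {μ : Multiset ℕ} (h : GapFree μ) (hμ : μ ≠ 0) :
    ∃ r a, Odd r ∧ SpansFrom r a μ := by
  have hne : μ.toFinset.Nonempty := Multiset.toFinset_nonempty.2 hμ
  have ha := Multiset.mem_toFinset.1 (μ.toFinset.min'_mem hne)
  have hb := Multiset.mem_toFinset.1 (μ.toFinset.max'_mem hne)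
  have hmin : ∀ x ∈ μ, μ.toFinset.min' hne ≤ x := fun x hx =>
    min'_le _ _ (Multiset.mem_toFinset.2 hx)
  have hmax : ∀ x ∈ μ, x ≤ μ.toFinset.max' hne := fun x hx =>
    le_max' _ _ (Multiset.mem_toFinset.2 hx)
  generalize μ.toFinset.min' hne = a at *
  generalize μ.toFinset.max' hne = b at *
  have hab := hmin b hb
  rcases Nat.even_or_odd (b - a) with he | ho
  · refine ⟨b - a + 1, a, he.add_one, fun x hx => ?_, fun x h1 h2 => h a ha b hb x h1 (by omega)⟩
    have := hmin x hx
    have := hmax x hx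
    omega
  · refine ⟨b - a, a, ho, fun x hx => ?_, fun x h1 h2 => h a ha b hb x h1 (by omega)⟩
    have := hmin x hx
    have := hmax x hx
    omega

open Classical in
theorem filter_gapFree_partsFinset {n : ℕ} (hn : 1 ≤ n) :
    (partsFinset n).filter GapFree =
      ((range (n + 1)).filter Odd).biUnion fun r => gapFreeParts r n := by
  ext μ
  simp only [mem_gapFreeParts, mem_filter, mem_biUnion, mem_range]
  constructor
  · rintro ⟨hp, hg⟩
    have hμ : μ ≠ 0 := by
      rintro rfl
      have := (mem_partsFinset.1 hp).2
      simp only [Multiset.sum_zero] at this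
      omega
    obtain ⟨r, a, hr, hs⟩ := hg.exists_spansFrom hμ
    have := card_le_of_mem_partsFinset hp
    have := hs.card_toFinset.1
    have := μ.toFinset_card_le
    exact ⟨r, ⟨by omega, hr⟩, hp, a, hs⟩
  · rintro ⟨r, -, hp, a, hs⟩
    exact ⟨hp, hs.gapFree⟩

open Classical in
theorem card_filter_gapFree {n : ℕ} (hn : 1 ≤ n) :
    #((partsFinset n).filter GapFree) = ∑ r ∈ (range (n + 1)).filter Odd, #(gapFreeParts r n) := by
  rw [filter_gapFree_partsFinset hn, card_biUnion]
  intro r hr s hs hrs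
  refine disjoint_left.2 fun μ h1 h2 => hrs ?_
  obtain ⟨-, a, ha⟩ := mem_gapFreeParts.1 h1
  obtain ⟨-, b, hb⟩ := mem_gapFreeParts.1 h2
  have h1 := ha.card_toFinset
  have h2 := hb.card_toFinset
  obtain ⟨k, rfl⟩ := (mem_filter.1 hr).2
  obtain ⟨l, rfl⟩ := (mem_filter.1 hs).2
  omega

theorem parts_injective (n : ℕ) : Function.Injective (Nat.Partition.parts (n := n)) :=
  fun _ _ h => Nat.Partition.ext h

open Classical in
theorem card_gapFree_partitions (n : ℕ) :
    Nat.card {c : n.Partition // GapFree c.parts} = #((partsFinset n).filter GapFree) := by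
  rw [partsFinset, filter_image, card_image_of_injective _ (parts_injective n),
    Nat.card_eq_fintype_card, Fintype.card_subtype]

theorem sum_distincts_odd (n : ℕ) (f : Multiset ℕ → ℕ) :
    ∑ c ∈ (Nat.Partition.distincts n).filter (fun c => Odd (Multiset.card c.parts)), f c.parts =
      ∑ r ∈ (range (n + 1)).filter Odd, ∑ μ ∈ distinctParts r n, f μ := by
  have himage : ((Nat.Partition.distincts n).filter
      (fun c => Odd (Multiset.card c.parts))).image Nat.Partition.parts =
        (partsFinset n).filter fun μ => μ.Nodup ∧ Odd (Multiset.card μ) := by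
    rw [partsFinset, filter_image, Nat.Partition.distincts, filter_filter]
  rw [← sum_image (f := f) fun _ _ _ _ h => parts_injective n h, himage,
    ← sum_fiberwise_of_maps_to (t := (range (n + 1)).filter Odd) (g := Multiset.card)]
  · refine sum_congr rfl fun r hr => sum_congr ?_ fun _ _ => rfl
    rw [filter_filter]
    refine filter_congr fun μ _ => ?_
    have := (mem_filter.1 hr).2
    grind
  · intro μ hμ
    obtain ⟨hp, -, ho⟩ := mem_filter.1 hμ
    exact mem_filter.2 ⟨mem_range.2 (Nat.lt_succ_of_le (card_le_of_mem_partsFinset hp)), ho⟩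

/-- For `n ≥ 1`, the number of gap-free partitions of `n` equals the sum of the smallest
parts over all distinct partitions of `n` with an odd number of parts. -/
theorem gap_free_eq_sum_smallest_odd (n : ℕ) (hn : 1 ≤ n) :
    Nat.card {c : n.Partition // GapFree c.parts} =
      ∑ c ∈ (Nat.Partition.distincts n).filter (fun c => Odd (Multiset.card c.parts)),
        sInf {p | p ∈ c.parts} := by
  rw [card_gapFree_partitions, card_filter_gapFree hn,
    sum_distincts_odd n fun μ => sInf {p | p ∈ μ}]
  exact sum_congr rfl fun r hr => card_gapFreeParts_eq_sum (mem_filter.1 hr).2.pos n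
end

section
/- For every n ≥ 1, conjugation of partitions restricts to a bijection from the set G_I(n) of gap-free partitions of n whose smallest part is 1 and whose largest part is odd onto the set of partitions of n into distinct parts with an odd number of parts; moreover, for each λ ∈ G_I(n), the multiplicity of the largest part of λ equals the smallest part of the conjugate partition λ'. -/
/-- The multiset of parts of the conjugate partition: its parts are the numbers
`#{p ∈ μ | p ≥ i}` for `i ≥ 1`, zero values being discarded. -/
def conjParts (μ : Multiset ℕ) : Multiset ℕ :=
  ((Finset.Icc 1 μ.sum).val.map
    (fun i => Multiset.card (μ.filter (fun p => i ≤ p)))).filter (fun v => 0 < v)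

theorem antitone_card_filter_le (μ : Multiset ℕ) :
    Antitone fun i => Multiset.card (μ.filter (fun p => i ≤ p)) := fun _ _ hij =>
  Multiset.card_le_card (Multiset.monotone_filter_right μ fun _ h => hij.trans h)

theorem card_filter_le_pos_iff {μ : Multiset ℕ} {i : ℕ} :
    0 < Multiset.card (μ.filter (fun p => i ≤ p)) ↔ ∃ p ∈ μ, i ≤ p := by
  simp [Multiset.card_pos_iff_exists_mem]

theorem card_filter_le_eq_add_count (μ : Multiset ℕ) (i : ℕ) :
    Multiset.card (μ.filter (fun p => i ≤ p)) =
      Multiset.card (μ.filter (fun p => i + 1 ≤ p)) + μ.count i := by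
  induction μ using Multiset.induction with
  | empty => simp
  | cons a s ih =>
    simp only [Multiset.filter_cons, Multiset.card_add, Multiset.count_cons, ih]
    rcases lt_trichotomy a i with h | h | h
    · simp [show ¬ i ≤ a by omega, show ¬ i + 1 ≤ a by omega, h.ne']
    · subst h
      simp
      omega
    · simp [h.le, show i + 1 ≤ a by omega, h.ne]
      omega

theorem mem_conjParts {μ : Multiset ℕ} {v : ℕ} :
    v ∈ conjParts μ ↔
      0 < v ∧ ∃ i, 1 ≤ i ∧ Multiset.card (μ.filter (fun p => i ≤ p)) = v := by
  simp only [conjParts, Multiset.mem_filter, Multiset.mem_map, Finset.mem_val, Finset.mem_Icc]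
  constructor
  · rintro ⟨⟨i, hi, rfl⟩, hv⟩
    exact ⟨hv, i, hi.1, rfl⟩
  · rintro ⟨hv, i, hi, rfl⟩
    obtain ⟨p, hp, hip⟩ := card_filter_le_pos_iff.1 hv
    exact ⟨⟨i, ⟨hi, hip.trans (Multiset.le_sum_of_mem hp)⟩, rfl⟩, hv⟩

theorem pos_of_mem_conjParts {μ : Multiset ℕ} {v : ℕ} (h : v ∈ conjParts μ) : 0 < v :=
  (mem_conjParts.1 h).1

theorem conjParts_eq_map_filter (μ : Multiset ℕ) :
    conjParts μ = ((Finset.Icc 1 μ.sum).filter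
      (fun i => 0 < Multiset.card (μ.filter (fun p => i ≤ p)))).val.map
        (fun i => Multiset.card (μ.filter (fun p => i ≤ p))) := by
  rw [conjParts, Multiset.filter_map, Finset.filter_val]
  rfl

theorem card_filter_le_conjParts (μ : Multiset ℕ) {j : ℕ} (hj : 1 ≤ j) :
    Multiset.card ((conjParts μ).filter (fun p => j ≤ p)) =
      ((Finset.Icc 1 μ.sum).filter
        (fun i => j ≤ Multiset.card (μ.filter (fun p => i ≤ p)))).card := by
  rw [conjParts, Multiset.filter_filter, Multiset.filter_map, Multiset.card_map,
    Finset.card_def, Finset.filter_val]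
  congr 1
  apply Multiset.filter_congr
  intro i _
  simp only [Function.comp]
  omega

/-- The Galois correspondence between a partition and its conjugate. -/
theorem le_card_filter_le_conjParts_iff (μ : Multiset ℕ) {i j : ℕ} (hi : 1 ≤ i) (hj : 1 ≤ j) :
    i ≤ Multiset.card ((conjParts μ).filter (fun p => j ≤ p)) ↔
      j ≤ Multiset.card (μ.filter (fun p => i ≤ p)) := by
  rw [card_filter_le_conjParts μ hj]
  constructor
  · intro h
    by_contra hlt
    have hsub : (Finset.Icc 1 μ.sum).filter
        (fun k => j ≤ Multiset.card (μ.filter (fun p => k ≤ p))) ⊆ Finset.Icc 1 (i - 1) := by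
      intro k hk
      simp only [Finset.mem_filter, Finset.mem_Icc] at hk ⊢
      refine ⟨hk.1.1, ?_⟩
      by_contra hki
      exact hlt (hk.2.trans (antitone_card_filter_le μ (show i ≤ k by omega)))
    have := Finset.card_le_card hsub
    rw [Nat.card_Icc] at this
    omega
  · intro h
    obtain ⟨p, hp, hip⟩ := card_filter_le_pos_iff.1 (hj.trans h)
    have hpN := Multiset.le_sum_of_mem hp
    have hsub : Finset.Icc 1 i ⊆ (Finset.Icc 1 μ.sum).filter
        (fun k => j ≤ Multiset.card (μ.filter (fun p => k ≤ p))) := by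
      intro k hk
      simp only [Finset.mem_filter, Finset.mem_Icc] at hk ⊢
      exact ⟨⟨hk.1, by omega⟩, h.trans (antitone_card_filter_le μ hk.2)⟩
    simpa using Finset.card_le_card hsub

theorem conjParts_conjParts {μ : Multiset ℕ} (hμ : ∀ p ∈ μ, 0 < p) :
    conjParts (conjParts μ) = μ := by
  have key : ∀ i, 1 ≤ i →
      Multiset.card ((conjParts (conjParts μ)).filter (fun p => i ≤ p)) =
        Multiset.card (μ.filter (fun p => i ≤ p)) := by
    intro i hi
    have h : ∀ j, 1 ≤ j →
        (j ≤ Multiset.card ((conjParts (conjParts μ)).filter (fun p => i ≤ p)) ↔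
          j ≤ Multiset.card (μ.filter (fun p => i ≤ p))) := fun j hj =>
      (le_card_filter_le_conjParts_iff _ hj hi).trans (le_card_filter_le_conjParts_iff _ hi hj)
    apply le_antisymm
    · by_contra hlt
      have := (h _ (by omega)).1 le_rfl
      omega
    · by_contra hlt
      have := (h _ (by omega)).2 le_rfl
      omega
  ext i
  rcases Nat.eq_zero_or_pos i with rfl | hi
  · rw [Multiset.count_eq_zero_of_notMem fun h => (pos_of_mem_conjParts h).false,
      Multiset.count_eq_zero_of_notMem fun h => (hμ _ h).false]
  · have h₁ := card_filter_le_eq_add_count μ i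
    have h₂ := card_filter_le_eq_add_count (conjParts (conjParts μ)) i
    rw [key i hi, key (i + 1) (by omega)] at h₂
    omega

theorem sum_Icc_card_filter_le (μ : Multiset ℕ) {M : ℕ} (hM : ∀ p ∈ μ, p ≤ M) :
    ∑ i ∈ Finset.Icc 1 M, Multiset.card (μ.filter (fun p => i ≤ p)) = μ.sum := by
  induction μ using Multiset.induction with
  | empty => simp
  | cons a s ih =>
    have ha : a ≤ M := hM a (Multiset.mem_cons_self a s)
    have hcard : (Finset.Icc 1 M).filter (fun i => i ≤ a) = Finset.Icc 1 a := by
      ext i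
      simp only [Finset.mem_filter, Finset.mem_Icc]
      omega
    have hif : ∀ i, Multiset.card (if i ≤ a then ({a} : Multiset ℕ) else 0) =
        if i ≤ a then 1 else 0 := by
      intro i
      split_ifs <;> simp
    simp only [Multiset.filter_cons, Multiset.card_add, Finset.sum_add_distrib,
      Multiset.sum_cons, hif, ih fun p hp => hM p (Multiset.mem_cons_of_mem hp)]
    rw [← Finset.card_filter, hcard]
    simp

theorem sum_conjParts (μ : Multiset ℕ) : (conjParts μ).sum = μ.sum := by
  rw [← sum_Icc_card_filter_le μ fun _ hp => Multiset.le_sum_of_mem hp, conjParts_eq_map_filter]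
  change ∑ i ∈ (Finset.Icc 1 μ.sum).filter _, _ = _
  apply Finset.sum_filter_of_ne
  intro i _ h
  exact Nat.pos_of_ne_zero h

/-- The number of parts of the conjugate is the largest part. -/
theorem le_card_conjParts_iff (μ : Multiset ℕ) {i : ℕ} (hi : 1 ≤ i) :
    i ≤ Multiset.card (conjParts μ) ↔ ∃ p ∈ μ, i ≤ p := by
  rw [← card_filter_le_pos_iff, ← Nat.succ_le_iff,
    ← le_card_filter_le_conjParts_iff μ hi le_rfl,
    Multiset.filter_eq_self (p := fun p => 1 ≤ p) |>.2 fun _ h => pos_of_mem_conjParts h]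

theorem isGreatest_card_conjParts {μ : Multiset ℕ} (hμ : ∀ p ∈ μ, 0 < p) (h0 : μ ≠ 0) :
    IsGreatest {p | p ∈ μ} (Multiset.card (conjParts μ)) := by
  have hub : ∀ p ∈ μ, p ≤ Multiset.card (conjParts μ) := fun p hp =>
    (le_card_conjParts_iff μ (hμ p hp)).2 ⟨p, hp, le_rfl⟩
  refine ⟨?_, hub⟩
  obtain ⟨p, hp⟩ := Multiset.exists_mem_of_ne_zero h0
  obtain ⟨q, hq, hle⟩ := (le_card_conjParts_iff μ ((hμ p hp).trans_le (hub p hp))).1 le_rfl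
  exact le_antisymm hle (hub q hq) ▸ hq

theorem sSup_parts_eq_card_conjParts {μ : Multiset ℕ} (hμ : ∀ p ∈ μ, 0 < p) (h0 : μ ≠ 0) :
    sSup {p | p ∈ μ} = Multiset.card (conjParts μ) :=
  (isGreatest_card_conjParts hμ h0).csSup_eq

theorem gapFree_and_one_mem_iff {μ : Multiset ℕ} (hμ : ∀ p ∈ μ, 0 < p) (h0 : μ ≠ 0) :
    GapFree μ ∧ 1 ∈ μ ↔ ∀ i, 1 ≤ i → (∃ p ∈ μ, i ≤ p) → i ∈ μ := by
  constructor
  · rintro ⟨hg, h1⟩ i hi ⟨p, hp, hip⟩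
    exact hg 1 h1 p hp i hi hip
  · intro h
    obtain ⟨p, hp⟩ := Multiset.exists_mem_of_ne_zero h0
    exact ⟨fun p hp q hq r hpr hrq => h r ((hμ p hp).trans_le hpr) ⟨q, hq, hrq⟩,
      h 1 le_rfl ⟨p, hp, hμ p hp⟩⟩

theorem nodup_conjParts_iff {μ : Multiset ℕ} (hμ : ∀ p ∈ μ, 0 < p) (h0 : μ ≠ 0) :
    (conjParts μ).Nodup ↔ GapFree μ ∧ 1 ∈ μ := by
  rw [gapFree_and_one_mem_iff hμ h0, conjParts_eq_map_filter,
    Multiset.nodup_map_iff_inj_on (Finset.nodup _)]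
  simp only [Finset.mem_val, Finset.mem_filter, Finset.mem_Icc, card_filter_le_pos_iff]
  constructor
  · rintro hinj i hi ⟨p, hp, hip⟩
    by_contra hmem
    have hlt : i + 1 ≤ p := lt_of_le_of_ne hip fun h => hmem (h ▸ hp)
    have hpN := Multiset.le_sum_of_mem hp
    have heq := card_filter_le_eq_add_count μ i
    rw [Multiset.count_eq_zero_of_notMem hmem, add_zero] at heq
    have := hinj i ⟨⟨hi, by omega⟩, p, hp, hip⟩ (i + 1) ⟨⟨by omega, by omega⟩, p, hp, hlt⟩ heq
    omega
  · intro h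
    have hne : ∀ i j, 1 ≤ i → (∃ p ∈ μ, i ≤ p) → i < j →
        Multiset.card (μ.filter (fun p => j ≤ p)) <
          Multiset.card (μ.filter (fun p => i ≤ p)) := by
      intro i j hi hp hij
      have hcount := Multiset.count_pos.2 (h i hi hp)
      have heq := card_filter_le_eq_add_count μ i
      have hle := antitone_card_filter_le μ (Nat.succ_le_of_lt hij)
      simp only [Nat.succ_eq_add_one] at hle
      omega
    rintro i ⟨⟨hi, -⟩, hip⟩ j ⟨⟨hj, -⟩, hjp⟩ heq
    rcases lt_trichotomy i j with hij | hij | hij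
    · exact absurd heq (hne i j hi hip hij).ne'
    · exact hij
    · exact absurd heq (hne j i hj hjp hij).ne

theorem count_sSup_eq_sInf_conjParts {μ : Multiset ℕ} (hμ : ∀ p ∈ μ, 0 < p) (h0 : μ ≠ 0) :
    μ.count (sSup {p | p ∈ μ}) = sInf {p | p ∈ conjParts μ} := by
  have hgr := isGreatest_card_conjParts hμ h0
  rw [hgr.csSup_eq]
  set M := Multiset.card (conjParts μ)
  have hcount : Multiset.card (μ.filter (fun p => M ≤ p)) = μ.count M := by
    rw [card_filter_le_eq_add_count, Multiset.filter_eq_nil.2 fun p hp => by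
      have : p ≤ M := hgr.2 hp
      omega]
    simp
  refine (IsLeast.csInf_eq ⟨?_, ?_⟩).symm
  · exact mem_conjParts.2 ⟨Multiset.count_pos.2 hgr.1, M, hμ M hgr.1, hcount⟩
  · intro v hv
    obtain ⟨hpos, i, -, rfl⟩ := mem_conjParts.1 hv
    obtain ⟨p, hp, hip⟩ := card_filter_le_pos_iff.1 hpos
    rw [← hcount]
    exact antitone_card_filter_le μ (hip.trans (hgr.2 hp))

/-- The conjugate of a partition, with parts given by `conjParts`. -/
def conjPartition {n : ℕ} (c : n.Partition) : n.Partition where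
  parts := conjParts c.parts
  parts_pos := pos_of_mem_conjParts
  parts_sum := (sum_conjParts c.parts).trans c.parts_sum

theorem conjPartition_conjPartition {n : ℕ} (c : n.Partition) :
    conjPartition (conjPartition c) = c :=
  Nat.Partition.ext (conjParts_conjParts fun _ => c.parts_pos)

theorem parts_ne_zero {n : ℕ} (hn : 1 ≤ n) (c : n.Partition) : c.parts ≠ 0 := by
  intro h
  have := c.parts_sum
  rw [h, Multiset.sum_zero] at this
  omega

theorem conjPartition_mem_distinct_iff {n : ℕ} (hn : 1 ≤ n) (c : n.Partition) :
    (GapFree c.parts ∧ 1 ∈ c.parts ∧ Odd (sSup {p | p ∈ c.parts})) ↔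
      (conjPartition c).parts.Nodup ∧ Odd (Multiset.card (conjPartition c).parts) := by
  have hpos : ∀ p ∈ c.parts, 0 < p := fun _ => c.parts_pos
  rw [← and_assoc, ← nodup_conjParts_iff hpos (parts_ne_zero hn c),
    sSup_parts_eq_card_conjParts hpos (parts_ne_zero hn c)]
  rfl

/-- For `n ≥ 1`, conjugation restricts to a bijection from the gap-free partitions of `n`
with smallest part `1` and odd largest part onto the distinct partitions of `n` with an odd
number of parts; moreover the multiplicity of the largest part of `λ` equals the smallest
part of the conjugate `λ'`. -/
theorem conjugate_bijection_odd (n : ℕ) (hn : 1 ≤ n) :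
    ∃ e : {c : n.Partition //
            GapFree c.parts ∧ 1 ∈ c.parts ∧ Odd (sSup {p | p ∈ c.parts})} ≃
          {c : n.Partition // c.parts.Nodup ∧ Odd (Multiset.card c.parts)},
      ∀ c, (e c).1.parts = conjParts c.1.parts ∧
        c.1.parts.count (sSup {p | p ∈ c.1.parts}) = sInf {p | p ∈ (e c).1.parts} := by
  exact ⟨(Function.Involutive.toPerm conjPartition conjPartition_conjPartition).subtypeEquiv
      (conjPartition_mem_distinct_iff hn), fun c => ⟨rfl,
    count_sSup_eq_sInf_conjParts (fun _ => c.1.parts_pos) (parts_ne_zero hn c.1)⟩⟩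
end

section
/- For every n ≥ 1, the number of gap-free partitions of n having at least two distinct part values equals the sum of the smallest parts over all partitions of n into distinct parts having an even number of parts. -/
namespace GapFreeCount

open Finset

/-- Translation of a finite set of naturals by one. -/
def shift (S : Finset ℕ) : Finset ℕ := S.map (addRightEmbedding 1)

lemma mem_shift {S : Finset ℕ} {x : ℕ} : x ∈ shift S ↔ ∃ y ∈ S, y + 1 = x := by
  simp [shift]

lemma card_shift (S : Finset ℕ) : (shift S).card = S.card := by simp [shift]

lemma sum_shift (S : Finset ℕ) : ∑ x ∈ shift S, x = ∑ x ∈ S, x + S.card := by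
  simp [shift, sum_add_distrib]

lemma shift_injective : Function.Injective shift := Finset.map_injective _

lemma zero_notMem_shift (S : Finset ℕ) : 0 ∉ shift S := by simp [mem_shift]

lemma exists_shift_eq {S : Finset ℕ} (h : 0 ∉ S) : ∃ T, shift T = S := by
  refine ⟨S.image Nat.pred, ?_⟩
  ext x
  simp only [mem_shift, mem_image]
  constructor
  · rintro ⟨_, ⟨y, hy, rfl⟩, rfl⟩
    have : y ≠ 0 := fun h0 => h (h0 ▸ hy)
    rwa [← Nat.succ_eq_add_one, Nat.succ_pred this]
  · intro hx
    have : x ≠ 0 := fun h0 => h (h0 ▸ hx)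
    exact ⟨x.pred, ⟨x, hx, rfl⟩, Nat.succ_pred this⟩

/-- Replacement of the element `m` by `0`. -/
def swapZero (m : ℕ) (S : Finset ℕ) : Finset ℕ := insert 0 (S.erase m)

lemma card_swapZero {m : ℕ} {S : Finset ℕ} (hm : m ∈ S) (h0 : 0 ∉ S) :
    (swapZero m S).card = S.card := by
  rw [swapZero, card_insert_of_notMem (by simp [h0]), card_erase_add_one hm]

lemma sum_swapZero {m : ℕ} {S : Finset ℕ} (hm : m ∈ S) (h0 : 0 ∉ S) :
    ∑ x ∈ swapZero m S, x + m = ∑ x ∈ S, x := by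
  rw [swapZero, sum_insert (by simp [h0]), zero_add, sum_erase_add _ _ hm]

lemma swapZero_inj {m : ℕ} {S T : Finset ℕ} (hS : m ∈ S) (hT : m ∈ T) (hS0 : 0 ∉ S)
    (hT0 : 0 ∉ T) (h : swapZero m S = swapZero m T) : S = T := by
  have := congrArg (fun U => insert m (U.erase 0)) h
  simpa [swapZero, hS0, hT0, hS, hT] using this

lemma exists_swapZero_eq {m : ℕ} {U : Finset ℕ} (h0 : 0 ∈ U) (hm : m ∉ U) :
    ∃ S, m ∈ S ∧ 0 ∉ S ∧ swapZero m S = U := by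
  have : m ≠ 0 := fun h => hm (h ▸ h0)
  exact ⟨insert m (U.erase 0), by simp, by simp [this.symm],
    by simp [swapZero, hm, h0]⟩

/-- The partitions of `n` into `k` distinct positive parts, as finite sets. -/
def distinctSets (k n : ℕ) : Finset (Finset ℕ) :=
  ((Icc 1 n).powersetCard k).filter fun S => ∑ x ∈ S, x = n

lemma mem_distinctSets {k n : ℕ} {S : Finset ℕ} :
    S ∈ distinctSets k n ↔ 0 ∉ S ∧ S.card = k ∧ ∑ x ∈ S, x = n := by
  simp only [distinctSets, mem_filter, mem_powersetCard, and_assoc]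
  constructor
  · rintro ⟨h, hk, hs⟩
    exact ⟨fun h0 => by simpa using h h0, hk, hs⟩
  · rintro ⟨h0, hk, hs⟩
    refine ⟨fun x hx => mem_Icc.2 ⟨?_, ?_⟩, hk, hs⟩
    · exact Nat.pos_of_ne_zero fun h => h0 (h ▸ hx)
    · exact hs ▸ single_le_sum (f := fun x : ℕ => x) (fun _ _ => Nat.zero_le _) hx

/-- Partitions of `n` into `k` distinct parts, with a positive integer `t` bounding all parts
from below. -/
def markedSets (k n : ℕ) : Finset (Finset ℕ × ℕ) :=
  (distinctSets k n ×ˢ Icc 1 n).filter fun p => ∀ x ∈ p.1, p.2 ≤ x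

lemma mem_markedSets {k n : ℕ} (hk : 0 < k) {S : Finset ℕ} {t : ℕ} :
    (S, t) ∈ markedSets k n ↔ 0 < t ∧ (∀ x ∈ S, t ≤ x) ∧ S.card = k ∧ ∑ x ∈ S, x = n := by
  simp only [markedSets, mem_filter, mem_product, mem_distinctSets, mem_Icc]
  constructor
  · rintro ⟨⟨⟨h0, hc, hs⟩, ht, _⟩, h⟩
    exact ⟨ht, h, hc, hs⟩
  · rintro ⟨ht, h, hc, hs⟩
    refine ⟨⟨⟨fun h0 => ?_, hc, hs⟩, ht, ?_⟩, h⟩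
    · have := h 0 h0
      omega
    · obtain ⟨x, hx⟩ := card_pos.1 (hc ▸ hk)
      exact (h x hx).trans
        (hs ▸ single_le_sum (f := fun x : ℕ => x) (fun _ _ => Nat.zero_le _) hx)

/-- Triples `(m, r, S)` with `r` positive, `S` a set of `k` naturals below `m`, and
`r * m + ∑ S = n`. -/
def triples (k n : ℕ) : Finset (ℕ × ℕ × Finset ℕ) :=
  (Icc 1 n ×ˢ Icc 1 n ×ˢ (range n).powersetCard k).filter fun p =>
    (∀ x ∈ p.2.2, x < p.1) ∧ p.2.1 * p.1 + ∑ x ∈ p.2.2, x = n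

lemma mem_triples {k n : ℕ} (hk : 0 < k) {m r : ℕ} {S : Finset ℕ} :
    (m, r, S) ∈ triples k n ↔
      0 < r ∧ (∀ x ∈ S, x < m) ∧ S.card = k ∧ r * m + ∑ x ∈ S, x = n := by
  simp only [triples, mem_filter, mem_product, mem_Icc, mem_powersetCard]
  constructor
  · rintro ⟨⟨_, ⟨hr, _⟩, _, hc⟩, h, hs⟩
    exact ⟨hr, h, hc, hs⟩
  · rintro ⟨hr, h, hc, hs⟩
    obtain ⟨x, hx⟩ := card_pos.1 (hc ▸ hk)
    have hm : 0 < m := (Nat.zero_le x).trans_lt (h x hx)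
    have h1 : m ≤ r * m := Nat.le_mul_of_pos_left m hr
    have h2 : r ≤ r * m := Nat.le_mul_of_pos_right r hm
    refine ⟨⟨⟨hm, by omega⟩, ⟨hr, by omega⟩, fun y hy => mem_range.2 ?_, hc⟩, h, hs⟩
    have := h y hy
    omega

lemma card_markedSets_add {k : ℕ} (hk : 0 < k) (n : ℕ) :
    (markedSets k (n + k)).card = (distinctSets k (n + k)).card + (markedSets k n).card := by
  have hU : markedSets k (n + k) = (distinctSets k (n + k)).image (fun S => (S, 1)) ∪
      (markedSets k n).image (fun p => (shift p.1, p.2 + 1)) := by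
    ext ⟨S, t⟩
    simp only [mem_union, mem_image, Prod.exists, Prod.mk.injEq, mem_markedSets hk,
      mem_distinctSets]
    constructor
    · rintro ⟨ht, h, hc, hs⟩
      have h0 : 0 ∉ S := fun h0 => by
        have := h 0 h0
        omega
      rcases (show t = 1 ∨ 2 ≤ t by omega) with rfl | ht
      · exact Or.inl ⟨S, ⟨h0, hc, hs⟩, rfl, rfl⟩
      · obtain ⟨T, rfl⟩ := exists_shift_eq h0
        rw [card_shift] at hc
        rw [sum_shift] at hs
        refine Or.inr ⟨T, t - 1, ⟨by omega, fun x hx => ?_, hc, by omega⟩, rfl, by omega⟩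
        have := h (x + 1) (mem_shift.2 ⟨x, hx, rfl⟩)
        omega
    · rintro (⟨_, ⟨h0, hc, hs⟩, rfl, rfl⟩ | ⟨T, t, ⟨ht, h, hc, hs⟩, rfl, rfl⟩)
      · exact ⟨one_pos, fun x hx => Nat.pos_of_ne_zero fun h => h0 (h ▸ hx), hc, hs⟩
      · refine ⟨by omega, fun x hx => ?_, by rw [card_shift, hc], by rw [sum_shift, hc, hs]⟩
        obtain ⟨y, hy, rfl⟩ := mem_shift.1 hx
        have := h y hy
        omega
  rw [hU, card_union_of_disjoint, card_image_of_injective, card_image_of_injective]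
  · rintro ⟨S, s⟩ ⟨T, t⟩ h
    simp only [Prod.mk.injEq, add_left_inj] at h
    exact Prod.ext (shift_injective h.1) h.2
  · exact fun S T h => (Prod.mk.inj h).1
  · rw [disjoint_left]
    rintro ⟨S, t⟩ h h'
    obtain ⟨_, _, h⟩ := mem_image.1 h
    obtain ⟨⟨T, u⟩, hp, h'⟩ := mem_image.1 h'
    have := ((mem_markedSets hk).1 hp).1
    simp only [Prod.mk.injEq] at h h'
    omega

/-- Embedding of the triples of `n` into those of `n + k`. -/
def raise (p : ℕ × ℕ × Finset ℕ) : ℕ × ℕ × Finset ℕ :=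
  if p.1 ∈ shift p.2.2 then (p.1, p.2.1 + 1, swapZero p.1 (shift p.2.2))
  else (p.1, p.2.1, shift p.2.2)

lemma raise_injective : Function.Injective raise := by
  rintro ⟨m, r, S⟩ ⟨m', r', S'⟩ h
  have h0 := zero_notMem_shift S
  have h0' := zero_notMem_shift S'
  have hz : ∀ m T, 0 ∈ swapZero m T := fun m T => mem_insert_self _ _
  unfold raise at h
  split_ifs at h with h1 h2 h2 <;> simp only [Prod.mk.injEq] at h <;> obtain ⟨rfl, hr, hS⟩ := h
  · have := shift_injective (swapZero_inj h1 h2 h0 h0' hS)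
    simp_all
  · exact absurd (hS ▸ hz _ _) h0'
  · exact absurd (hS ▸ hz _ _) h0
  · have := shift_injective hS
    simp_all

lemma le_sup_of_mem {S : Finset ℕ} {x : ℕ} (hx : x ∈ S) : x ≤ S.sup id :=
  le_sup (f := id) hx

lemma sup_mem {S : Finset ℕ} (h : S.Nonempty) : S.sup id ∈ S := by
  obtain ⟨x, hx, h⟩ := exists_mem_eq_sup S h id
  exact h ▸ hx

lemma card_triples_add {k : ℕ} (hk : 0 < k) (n : ℕ) :
    (triples k (n + k)).card = (distinctSets k (n + k)).card + (triples k n).card := by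
  have hU : triples k (n + k) =
      (distinctSets k (n + k)).image (fun S => (S.sup id, 1, swapZero (S.sup id) S)) ∪
      (triples k n).image raise := by
    ext ⟨m, r, U⟩
    simp only [mem_union, mem_image, Prod.exists, Prod.mk.injEq, mem_triples hk,
      mem_distinctSets]
    constructor
    · rintro ⟨hr, h, hc, hs⟩
      have hmU : m ∉ U := fun hm => lt_irrefl _ (h m hm)
      by_cases h0 : 0 ∈ U
      · obtain ⟨S, hmS, hS0, rfl⟩ := exists_swapZero_eq h0 hmU
        have hle : ∀ x ∈ S, x ≤ m := fun x hx => by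
          by_cases hxm : x = m
          · exact hxm.le
          · exact (h x (mem_insert_of_mem (mem_erase.2 ⟨hxm, hx⟩))).le
        rw [card_swapZero hmS hS0] at hc
        have hsum := sum_swapZero hmS hS0
        rcases (show r = 1 ∨ 2 ≤ r by omega) with rfl | hr2
        · have hm : S.sup id = m := le_antisymm (Finset.sup_le hle) (le_sup_of_mem hmS)
          exact Or.inl ⟨S, ⟨hS0, hc, by omega⟩, hm, rfl, by rw [hm]⟩
        · obtain ⟨T, rfl⟩ := exists_shift_eq hS0
          obtain ⟨r, rfl⟩ := Nat.exists_eq_add_of_le' (show 1 ≤ r by omega)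
          rw [card_shift] at hc
          rw [sum_shift] at hsum
          rw [add_mul] at hs
          refine Or.inr ⟨m, r, T, ⟨by omega, fun x hx => hle _ (mem_shift.2 ⟨x, hx, rfl⟩), hc,
            by omega⟩, by simp [raise, hmS]⟩
      · obtain ⟨T, rfl⟩ := exists_shift_eq h0
        rw [card_shift] at hc
        rw [sum_shift] at hs
        refine Or.inr ⟨m, r, T, ⟨hr, fun x hx => ?_, hc, by omega⟩, by simp [raise, hmU]⟩
        have := h _ (mem_shift.2 ⟨x, hx, rfl⟩)
        omega
    · rintro (⟨S, ⟨h0, hc, hs⟩, rfl, rfl, rfl⟩ | ⟨m', r', T, ⟨hr, h, hc, hs⟩, he⟩)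
      · have hm := sup_mem (card_pos.1 (hc ▸ hk))
        have hsum := sum_swapZero hm h0
        refine ⟨one_pos, fun x hx => ?_, by rw [card_swapZero hm h0, hc], by omega⟩
        rcases mem_insert.1 hx with rfl | hx
        · exact Nat.pos_of_ne_zero fun h => h0 (h ▸ hm)
        · exact lt_of_le_of_ne (le_sup_of_mem (mem_of_mem_erase hx)) (ne_of_mem_erase hx)
      · have hle : ∀ x ∈ shift T, x ≤ m' := fun x hx => by
          obtain ⟨y, hy, rfl⟩ := mem_shift.1 hx
          exact h y hy
        have h0 := zero_notMem_shift T
        unfold raise at he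
        split_ifs at he with hm <;> simp only [Prod.mk.injEq] at he <;>
          obtain ⟨rfl, rfl, rfl⟩ := he
        · have hsum := sum_swapZero hm h0
          rw [sum_shift] at hsum
          dsimp only at hsum
          refine ⟨by omega, fun x hx => ?_, by rw [card_swapZero hm h0, card_shift, hc], ?_⟩
          · rcases mem_insert.1 hx with rfl | hx
            · exact Nat.pos_of_ne_zero fun h => h0 (h ▸ hm)
            · exact lt_of_le_of_ne (hle x (mem_of_mem_erase hx)) (ne_of_mem_erase hx)
          · rw [add_mul]
            omega
        · refine ⟨hr, fun x hx => ?_, by rw [card_shift, hc], by rw [sum_shift]; omega⟩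
          exact lt_of_le_of_ne (hle x hx) fun h => hm (h ▸ hx)
  rw [hU, card_union_of_disjoint, card_image_of_injOn, card_image_of_injective _ raise_injective]
  · intro S hS T hT h
    obtain ⟨hS0, hSc, -⟩ := mem_distinctSets.1 hS
    obtain ⟨hT0, hTc, -⟩ := mem_distinctSets.1 hT
    have hm := sup_mem (card_pos.1 (hSc ▸ hk))
    have hm' := sup_mem (card_pos.1 (hTc ▸ hk))
    simp only [Prod.mk.injEq, true_and] at h
    rw [← h.1] at hm' h
    exact swapZero_inj hm hm' hS0 hT0 h.2
  · rw [disjoint_left]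
    rintro ⟨m, r, U⟩ h h'
    obtain ⟨S, _, h⟩ := mem_image.1 h
    obtain ⟨⟨m', r', T⟩, hp, h'⟩ := mem_image.1 h'
    have hr := ((mem_triples hk).1 hp).1
    simp only [Prod.mk.injEq] at h
    obtain ⟨rfl, rfl, rfl⟩ := h
    unfold raise at h'
    split_ifs at h' <;> simp only [Prod.mk.injEq] at h'
    · omega
    · exact zero_notMem_shift T (h'.2.2 ▸ mem_insert_self _ _)

/-- Partitions of `n` into `k` distinct parts, weighted by the smallest part, are equinumerous
with the triples `(m, r, S)`. -/
lemma card_markedSets_eq_card_triples {k : ℕ} (hk : 0 < k) (n : ℕ) :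
    (markedSets k n).card = (triples k n).card := by
  induction n using Nat.strong_induction_on with
  | _ n ih =>
    rcases lt_or_ge n k with hn | hn
    · have h1 : markedSets k n = ∅ := by
        refine eq_empty_of_forall_notMem fun ⟨S, t⟩ h => ?_
        obtain ⟨ht, h, hc, hs⟩ := (mem_markedSets hk).1 h
        have := card_nsmul_le_sum S (fun x => x) 1 fun x hx => ht.trans_le (h x hx)
        simp only [smul_eq_mul, mul_one] at this
        omega
      have h2 : triples k n = ∅ := by
        refine eq_empty_of_forall_notMem fun ⟨m, r, S⟩ h => ?_
        obtain ⟨hr, h, hc, hs⟩ := (mem_triples hk).1 h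
        have h3 := card_le_card (show S ⊆ range m from fun x hx => mem_range.2 (h x hx))
        have h4 : m ≤ r * m := Nat.le_mul_of_pos_left m hr
        rw [card_range] at h3
        omega
      rw [h1, h2, card_empty, card_empty]
    · obtain ⟨n, rfl⟩ := Nat.exists_eq_add_of_le' hn
      rw [card_markedSets_add hk, card_triples_add hk, ih n (by omega)]

/-- Triples `(m, r, S)` with `r` positive, `S` a nonempty set of integers strictly between `0`
and `m`, and `r * m + ∑ S = n`. -/
def cores (n : ℕ) : Finset (ℕ × ℕ × Finset ℕ) :=
  (Icc 1 n ×ˢ Icc 1 n ×ˢ (range n).powerset).filter fun p =>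
    p.2.2.Nonempty ∧ (∀ x ∈ p.2.2, 0 < x ∧ x < p.1) ∧ p.2.1 * p.1 + ∑ x ∈ p.2.2, x = n

lemma mem_cores {n m r : ℕ} {S : Finset ℕ} :
    (m, r, S) ∈ cores n ↔
      0 < r ∧ S.Nonempty ∧ (∀ x ∈ S, 0 < x ∧ x < m) ∧ r * m + ∑ x ∈ S, x = n := by
  simp only [cores, mem_filter, mem_product, mem_Icc, mem_powerset]
  constructor
  · rintro ⟨⟨_, ⟨hr, _⟩, _⟩, h⟩
    exact ⟨hr, h⟩
  · rintro ⟨hr, ⟨x, hx⟩, h, hs⟩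
    have hm : 0 < m := (Nat.zero_le x).trans_lt (h x hx).2
    have h1 : m ≤ r * m := Nat.le_mul_of_pos_left m hr
    have h2 : r ≤ r * m := Nat.le_mul_of_pos_right r hm
    refine ⟨⟨⟨hm, by omega⟩, ⟨hr, by omega⟩, fun y hy => mem_range.2 ?_⟩, ⟨x, hx⟩, h, hs⟩
    have := h y hy
    omega

/-- The positive even numbers up to `n`. -/
def evens (n : ℕ) : Finset ℕ := (Icc 1 n).filter Even

lemma mem_evens {n k : ℕ} : k ∈ evens n ↔ (0 < k ∧ k ≤ n) ∧ Even k := by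
  simp [evens, Nat.succ_le_iff]

lemma mem_biUnion_triples {n m r : ℕ} {S : Finset ℕ} :
    (m, r, S) ∈ (evens n).biUnion (triples · n) ↔
      0 < r ∧ (∀ x ∈ S, x < m) ∧ S.Nonempty ∧ Even S.card ∧ r * m + ∑ x ∈ S, x = n := by
  simp only [mem_biUnion, mem_evens]
  constructor
  · rintro ⟨k, ⟨⟨hk, _⟩, he⟩, hp⟩
    obtain ⟨hr, h, rfl, hs⟩ := (mem_triples hk).1 hp
    exact ⟨hr, h, card_pos.1 hk, he, hs⟩
  · rintro ⟨hr, h, hS, he, hs⟩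
    have hk := card_pos.2 hS
    refine ⟨S.card, ⟨⟨hk, ?_⟩, he⟩, (mem_triples hk).2 ⟨hr, h, rfl, hs⟩⟩
    have h3 := card_le_card (show S ⊆ range m from fun x hx => mem_range.2 (h x hx))
    have h4 : m ≤ r * m := Nat.le_mul_of_pos_left m hr
    rw [card_range] at h3
    omega

lemma sum_card_triples (n : ℕ) :
    ∑ k ∈ evens n, (triples k n).card = (cores n).card := by
  rw [← card_biUnion]
  · refine card_bij' (fun p _ => (p.1, p.2.1, p.2.2.erase 0))
      (fun p _ => (p.1, p.2.1, if Even p.2.2.card then p.2.2 else insert 0 p.2.2)) ?_ ?_ ?_ ?_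
    · rintro ⟨m, r, S⟩ h
      obtain ⟨hr, h, hS, he, hs⟩ := mem_biUnion_triples.1 h
      refine mem_cores.2 ⟨hr, ?_, fun x hx => ⟨?_, h x (mem_of_mem_erase hx)⟩, ?_⟩
      · rw [← card_pos]
        have h1 := pred_card_le_card_erase (s := S) (a := 0)
        have h2 := card_pos.2 hS
        dsimp only
        obtain ⟨t, ht⟩ := he
        omega
      · exact Nat.pos_of_ne_zero (ne_of_mem_erase hx)
      · rw [sum_erase (f := fun x : ℕ => x) S rfl, hs]
    · rintro ⟨m, r, S⟩ h
      obtain ⟨hr, hS, h, hs⟩ := mem_cores.1 h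
      have h0 : 0 ∉ S := fun h0 => lt_irrefl _ (h 0 h0).1
      dsimp only
      split_ifs with he
      · exact mem_biUnion_triples.2 ⟨hr, fun x hx => (h x hx).2, hS, he, hs⟩
      · refine mem_biUnion_triples.2 ⟨hr, fun x hx => ?_, insert_nonempty _ _, ?_, ?_⟩
        · obtain ⟨y, hy⟩ := hS
          rcases mem_insert.1 hx with rfl | hx
          · exact (h y hy).1.trans (h y hy).2
          · exact (h x hx).2
        · rw [card_insert_of_notMem h0]
          exact (Nat.not_even_iff_odd.1 he).add_one
        · rw [sum_insert h0, zero_add, hs]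
    · rintro ⟨m, r, S⟩ h
      obtain ⟨hr, h, hS, he, hs⟩ := mem_biUnion_triples.1 h
      by_cases h0 : 0 ∈ S
      · have h1 := card_erase_add_one h0
        have : ¬ Even (S.erase 0).card := by
          rw [← h1, Nat.even_add_one] at he
          exact he
        simp [this, insert_erase h0]
      · simp [erase_eq_of_notMem h0, he]
    · rintro ⟨m, r, S⟩ h
      obtain ⟨hr, hS, h, hs⟩ := mem_cores.1 h
      have h0 : 0 ∉ S := fun h0 => lt_irrefl _ (h 0 h0).1
      dsimp only
      split_ifs with he
      · rw [erase_eq_of_notMem h0]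
      · rw [erase_insert h0]
  · intro k hk l hl hkl
    rw [Function.onFun, disjoint_left]
    rintro ⟨m, r, S⟩ h h'
    exact hkl (((mem_triples (mem_evens.1 hk).1.1).1 h).2.2.1.symm.trans
      ((mem_triples (mem_evens.1 hl).1.1).1 h').2.2.1)

lemma card_markedSets_eq_sum_sInf {k : ℕ} (hk : 0 < k) (n : ℕ) :
    (markedSets k n).card = ∑ S ∈ distinctSets k n, sInf (S : Set ℕ) := by
  rw [markedSets, card_filter, sum_product]
  refine sum_congr rfl fun S hS => ?_
  obtain ⟨h0, hc, hs⟩ := mem_distinctSets.1 hS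
  have hne := card_pos.1 (hc ▸ hk)
  have hmem : sInf (S : Set ℕ) ∈ S := Nat.sInf_mem (s := (S : Set ℕ)) hne
  have hle : sInf (S : Set ℕ) ≤ n :=
    hs ▸ single_le_sum (f := fun x : ℕ => x) (fun _ _ => Nat.zero_le _) hmem
  rw [← card_filter]
  have : (Icc 1 n).filter (fun t => ∀ x ∈ S, t ≤ x) = Icc 1 (sInf (S : Set ℕ)) := by
    ext t
    simp only [mem_filter, mem_Icc]
    constructor
    · rintro ⟨⟨h1, _⟩, h⟩
      exact ⟨h1, h _ hmem⟩
    · rintro ⟨h1, h⟩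
      exact ⟨⟨h1, h.trans hle⟩, fun x hx => h.trans (Nat.sInf_le hx)⟩
  rw [this, Nat.card_Icc, Nat.add_sub_cancel]

lemma sum_sInf_parts (n : ℕ) (hn : 1 ≤ n) :
    ∑ c ∈ (Nat.Partition.distincts n).filter (fun c => Even (Multiset.card c.parts)),
        sInf {p | p ∈ c.parts} = ∑ k ∈ evens n, (markedSets k n).card := by
  rw [sum_congr rfl fun k hk => card_markedSets_eq_sum_sInf (mem_evens.1 hk).1.1 n,
    ← sum_biUnion]
  · refine sum_bij (fun c _ => c.parts.toFinset) ?_ ?_ ?_ ?_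
    · intro c hc
      obtain ⟨hc, he⟩ := mem_filter.1 hc
      have hd : c.parts.Nodup := (mem_filter.1 hc).2
      have hcard : c.parts.toFinset.card = Multiset.card c.parts :=
        Multiset.toFinset_card_of_nodup hd
      have hsum : ∑ x ∈ c.parts.toFinset, x = n := by
        rw [sum_eq_multiset_sum, Multiset.toFinset_val, hd.dedup, Multiset.map_id',
          c.parts_sum]
      have h0 : 0 ∉ c.parts.toFinset := fun h =>
        lt_irrefl _ (c.parts_pos (Multiset.mem_toFinset.1 h))
      refine mem_biUnion.2 ⟨Multiset.card c.parts, mem_evens.2 ⟨⟨?_, ?_⟩, he⟩,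
        mem_distinctSets.2 ⟨h0, hcard, hsum⟩⟩
      · rw [Multiset.card_pos]
        intro h
        have := c.parts_sum
        rw [h, Multiset.sum_zero] at this
        omega
      · have := card_nsmul_le_sum c.parts.toFinset (fun x => x) 1 fun x hx =>
          c.parts_pos (Multiset.mem_toFinset.1 hx)
        rwa [hsum, hcard, smul_eq_mul, mul_one] at this
    · intro c hc d hd h
      have hc : c.parts.Nodup := (mem_filter.1 (mem_filter.1 hc).1).2
      have hd : d.parts.Nodup := (mem_filter.1 (mem_filter.1 hd).1).2
      exact Nat.Partition.ext (by rw [← hc.dedup, ← hd.dedup]; exact congrArg Finset.val h)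
    · intro S hS
      obtain ⟨k, hk, hS⟩ := mem_biUnion.1 hS
      obtain ⟨h0, rfl, hs⟩ := mem_distinctSets.1 hS
      refine ⟨⟨S.val, fun {i} hi => Nat.pos_of_ne_zero fun h => h0 (h ▸ hi), ?_⟩, ?_, ?_⟩
      · rw [← hs, sum_eq_multiset_sum, Multiset.map_id']
      · exact mem_filter.2 ⟨mem_filter.2 ⟨mem_univ _, S.nodup⟩, (mem_evens.1 hk).2⟩
      · exact S.val_toFinset
    · intro c _
      congr 1
      ext p
      simp
  · intro k _ l _ hkl
    rw [Function.onFun, disjoint_left]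
    intro S h h'
    exact hkl ((mem_distinctSets.1 h).2.1.symm.trans (mem_distinctSets.1 h').2.1)

/-- The number of elements of `S` exceeding `i`. -/
def level (S : Finset ℕ) (i : ℕ) : ℕ := (S.filter (i < ·)).card

lemma level_antitone (S : Finset ℕ) : Antitone (level S) := fun _ _ h =>
  card_le_card (monotone_filter_right _ fun _ _ hx => h.trans_lt hx)

lemma level_eq_zero {S : Finset ℕ} {i : ℕ} (h : ∀ x ∈ S, x ≤ i) : level S i = 0 := by
  rw [level, card_eq_zero, filter_eq_empty_iff]
  exact fun x hx => not_lt.2 (h x hx)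

lemma level_zero {S : Finset ℕ} (h : ∀ x ∈ S, 0 < x) : level S 0 = S.card := by
  rw [level, filter_true_of_mem h]

lemma level_succ (S : Finset ℕ) (i : ℕ) :
    level S i = level S (i + 1) + if i + 1 ∈ S then 1 else 0 := by
  have h : S.filter (i < ·) = S.filter (i + 1 < ·) ∪ S.filter (i + 1 = ·) := by
    rw [← filter_or]
    refine filter_congr fun x _ => ?_
    omega
  rw [level, level, h, card_union_of_disjoint, filter_eq]
  · split_ifs <;> simp
  · exact disjoint_filter.2 fun x _ h1 h2 => h1.ne h2

lemma level_injective {S T : Finset ℕ} (hS : ∀ x ∈ S, 0 < x) (hT : ∀ x ∈ T, 0 < x)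
    (h : level S = level T) : S = T := by
  ext x
  rcases x with _ | x
  · exact iff_of_false (fun h => lt_irrefl _ (hS 0 h)) (fun h => lt_irrefl _ (hT 0 h))
  · have h1 := level_succ S x
    have h2 := level_succ T x
    rw [h] at h1
    split_ifs at h1 h2 <;> first | omega | simp_all

lemma sum_level {S : Finset ℕ} {m : ℕ} (h : ∀ x ∈ S, x ≤ m) :
    ∑ i ∈ range m, level S i = ∑ x ∈ S, x := by
  simp only [level, card_filter]
  rw [sum_comm]
  refine sum_congr rfl fun x hx => ?_
  rw [← card_filter]
  have : (range m).filter (· < x) = range x := by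
    ext i
    have := h x hx
    simp only [mem_filter, mem_range]
    omega
  rw [this, card_range]

lemma exists_level_eq (S : Finset ℕ) {i j v : ℕ} (hij : i ≤ j) (hj : level S j ≤ v)
    (hi : v ≤ level S i) : ∃ l ≤ j, level S l = v := by
  induction j, hij using Nat.le_induction with
  | base => exact ⟨i, le_rfl, le_antisymm hj hi⟩
  | succ j hij ih =>
    by_cases h : level S j ≤ v
    · obtain ⟨l, hl, h⟩ := ih h
      exact ⟨l, by omega, h⟩
    · have := level_succ S j
      refine ⟨j + 1, le_rfl, ?_⟩
      split_ifs at this <;> omega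

/-- The conjugate of the partition with `r` parts equal to `m` and further parts `S`. -/
def conjParts (m r : ℕ) (S : Finset ℕ) : Multiset ℕ :=
  (range m).val.map fun i => r + level S i

lemma mem_conjParts {m r : ℕ} {S : Finset ℕ} {v : ℕ} :
    v ∈ conjParts m r S ↔ ∃ i < m, r + level S i = v := by
  simp [conjParts]

lemma sum_conjParts {m r : ℕ} {S : Finset ℕ} (h : ∀ x ∈ S, x ≤ m) :
    (conjParts m r S).sum = r * m + ∑ x ∈ S, x := by
  rw [conjParts, ← sum_eq_multiset_sum, sum_add_distrib, sum_level h]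
  simp [mul_comm]

lemma countP_conjParts (m r : ℕ) (S : Finset ℕ) (v : ℕ) :
    (conjParts m r S).countP (v ≤ ·) = ((range m).filter fun i => v ≤ r + level S i).card := by
  rw [conjParts, Multiset.countP_map]
  rfl

lemma gapFree_conjParts (m r : ℕ) (S : Finset ℕ) : GapFree (conjParts m r S) := by
  intro p hp q hq v hpv hvq
  obtain ⟨j, hj, rfl⟩ := mem_conjParts.1 hp
  obtain ⟨i, hi, rfl⟩ := mem_conjParts.1 hq
  rw [mem_conjParts]
  rcases le_total i j with hij | hij
  · obtain ⟨l, hl, h⟩ := exists_level_eq S (v := v - r) hij (by omega) (by omega)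
    exact ⟨l, by omega, by omega⟩
  · have := level_antitone S hij
    exact ⟨j, hj, by omega⟩

lemma two_le_card_conjParts {m r : ℕ} {S : Finset ℕ} (hS : S.Nonempty)
    (h : ∀ x ∈ S, 0 < x ∧ x < m) : 2 ≤ (conjParts m r S).toFinset.card := by
  obtain ⟨y, hy⟩ := hS
  have hm := h y hy
  refine one_lt_card.2 ⟨r + level S 0, ?_, r + level S (m - 1), ?_, ?_⟩
  · exact Multiset.mem_toFinset.2 (mem_conjParts.2 ⟨0, by omega, rfl⟩)
  · exact Multiset.mem_toFinset.2 (mem_conjParts.2 ⟨m - 1, by omega, rfl⟩)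
  · rw [level_zero fun x hx => (h x hx).1, level_eq_zero fun x hx => Nat.le_sub_one_of_lt (h x hx).2]
    have := card_pos.2 ⟨y, hy⟩
    omega

lemma le_iff_lt_card_filter {f : ℕ → ℕ} (hf : Antitone f) {m i : ℕ} (hi : i < m) (v : ℕ) :
    v ≤ f i ↔ i < ((range m).filter fun j => v ≤ f j).card := by
  constructor
  · intro h
    have : range (i + 1) ⊆ (range m).filter fun j => v ≤ f j := fun j hj => by
      rw [mem_range] at hj
      exact mem_filter.2 ⟨mem_range.2 (by omega), h.trans (hf (by omega))⟩
    simpa using card_le_card this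
  · contrapose!
    intro h
    have : ((range m).filter fun j => v ≤ f j) ⊆ range i := fun j hj => by
      by_contra hji
      rw [mem_range, not_lt] at hji
      exact absurd ((mem_filter.1 hj).2.trans (hf hji)) (not_le.2 h)
    simpa using card_le_card this

lemma conjParts_injective {m r m' r' : ℕ} {S S' : Finset ℕ} (hne : S.Nonempty)
    (h : ∀ x ∈ S, 0 < x ∧ x < m) (h' : ∀ x ∈ S', 0 < x ∧ x < m')
    (heq : conjParts m r S = conjParts m' r' S') : m = m' ∧ r = r' ∧ S = S' := by
  obtain rfl : m = m' := by simpa [conjParts] using congrArg Multiset.card heq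
  have hf : ∀ i < m, r + level S i = r' + level S' i := fun i hi => by
    refine eq_of_forall_le_iff fun v => ?_
    rw [le_iff_lt_card_filter ((level_antitone S).const_add r) hi,
      le_iff_lt_card_filter ((level_antitone S').const_add r') hi,
      ← countP_conjParts, ← countP_conjParts, heq]
  have hm : 0 < m := by
    obtain ⟨y, hy⟩ := hne
    exact (h y hy).1.trans (h y hy).2
  have hr : r = r' := by
    have := hf (m - 1) (by omega)
    rwa [level_eq_zero fun x hx => Nat.le_sub_one_of_lt (h x hx).2,
      level_eq_zero fun x hx => Nat.le_sub_one_of_lt (h' x hx).2] at this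
  refine ⟨rfl, hr, level_injective (fun x hx => (h x hx).1) (fun x hx => (h' x hx).1) ?_⟩
  funext i
  rcases lt_or_ge i m with hi | hi
  · have := hf i hi
    omega
  · rw [level_eq_zero fun x hx => (h x hx).2.le.trans hi,
      level_eq_zero fun x hx => (h' x hx).2.le.trans hi]

lemma eq_of_countP_le_eq {s t : Multiset ℕ}
    (h : ∀ v, s.countP (v ≤ ·) = t.countP (v ≤ ·)) : s = t := by
  have key : ∀ (u : Multiset ℕ) (v : ℕ),
      u.countP (v ≤ ·) = u.count v + u.countP (v + 1 ≤ ·) := fun u v => by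
    induction u using Multiset.induction_on with
    | empty => simp
    | cons a u ih =>
      simp only [Multiset.countP_cons, Multiset.count_cons, ih]
      split_ifs <;> omega
  ext v
  have h1 := key s v
  have h2 := key t v
  have h3 := h v
  have h4 := h (v + 1)
  omega

lemma countP_le_antitone (s : Multiset ℕ) : Antitone fun v => s.countP (v ≤ ·) := by
  intro u v huv
  simp only [Multiset.countP_eq_card_filter]
  exact Multiset.card_le_card (Multiset.monotone_filter_right s fun x hx => huv.trans hx)

lemma countP_le_lt {s : Multiset ℕ} {u v : ℕ} (hu : u ∈ s) (huv : u < v) :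
    s.countP (v ≤ ·) < s.countP (u ≤ ·) := by
  obtain ⟨t, rfl⟩ := Multiset.exists_cons_of_mem hu
  have := countP_le_antitone t huv.le
  dsimp only at this
  rw [Multiset.countP_cons_of_neg _ (not_le.2 huv), Multiset.countP_cons_of_pos _ le_rfl]
  exact Nat.lt_succ_of_le this

lemma exists_conjParts_eq {s : Multiset ℕ} (hs : GapFree s) (h2 : 2 ≤ s.toFinset.card)
    (hpos : ∀ x ∈ s, 0 < x) :
    ∃ m r S, 0 < r ∧ S.Nonempty ∧ (∀ x ∈ S, 0 < x ∧ x < m) ∧ conjParts m r S = s := by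
  obtain ⟨r, hr, hmin⟩ := exists_min_image s.toFinset id (card_pos.1 (by omega))
  rw [Multiset.mem_toFinset] at hr
  replace hmin : ∀ x ∈ s, r ≤ x := fun x hx => hmin x (Multiset.mem_toFinset.2 hx)
  set c : ℕ → ℕ := fun v => s.countP (v ≤ ·)
  have hanti : Antitone c := countP_le_antitone s
  have hlt : ∀ {u v}, u ∈ s → u < v → c v < c u := fun hu huv => countP_le_lt hu huv
  have hcr : ∀ {v}, v ≤ r → c v = Multiset.card s := fun hv =>
    Multiset.countP_eq_card.2 fun x hx => hv.trans (hmin x hx)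
  have hpart : ∀ {x}, x ∈ s.toFinset.erase r ↔ r < x ∧ x ∈ s := fun {x} => by
    rw [mem_erase, Multiset.mem_toFinset]
    exact ⟨fun h => ⟨lt_of_le_of_ne (hmin x h.2) h.1.symm, h.2⟩, fun h => ⟨h.1.ne', h.2⟩⟩
  have hinj : Set.InjOn c (s.toFinset.erase r) := fun x hx y hy hxy => by
    rcases lt_trichotomy x y with h | h | h
    · exact absurd hxy (hlt (hpart.1 hx).2 h).ne'
    · exact h
    · exact absurd hxy (hlt (hpart.1 hy).2 h).ne
  refine ⟨Multiset.card s, r, (s.toFinset.erase r).image c, hpos r hr, ?_, ?_, ?_⟩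
  · rw [image_nonempty, ← card_pos, card_erase_of_mem (Multiset.mem_toFinset.2 hr)]
    omega
  · intro x hx
    obtain ⟨u, hu, rfl⟩ := mem_image.1 hx
    obtain ⟨hru, hu⟩ := hpart.1 hu
    exact ⟨Multiset.countP_pos.2 ⟨u, hu, le_rfl⟩, hcr le_rfl ▸ hlt hr hru⟩
  · have hlevel : ∀ i < Multiset.card s, ∀ v,
        v ≤ r + level ((s.toFinset.erase r).image c) i ↔ i < c v := by
      intro i hi v
      rw [level, filter_image, card_image_of_injOn (hinj.mono (by
        exact_mod_cast filter_subset _ _))]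
      rcases le_or_gt v r with hv | hv
      · rw [hcr hv]
        exact iff_of_true (by omega) hi
      · constructor
        · contrapose!
          intro hle
          have : ((s.toFinset.erase r).filter fun u => i < c u) ⊆ Ioo r v := fun u hu => by
            obtain ⟨hu, hiu⟩ := mem_filter.1 hu
            refine mem_Ioo.2 ⟨(hpart.1 hu).1, ?_⟩
            by_contra! hvu
            have := hanti hvu
            omega
          have := card_le_card this
          rw [Nat.card_Ioo] at this
          omega
        · intro hlt'
          obtain ⟨w, hw, hvw⟩ := Multiset.countP_pos.1 ((Nat.zero_le i).trans_lt hlt')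
          have : Ioc r v ⊆ (s.toFinset.erase r).filter fun u => i < c u := fun u hu => by
            obtain ⟨h1, h3⟩ := mem_Ioc.1 hu
            exact mem_filter.2 ⟨hpart.2 ⟨h1, hs r hr w hw u h1.le (h3.trans hvw)⟩,
              hlt'.trans_le (hanti h3)⟩
          have := card_le_card this
          rw [Nat.card_Ioc] at this
          omega
    refine eq_of_countP_le_eq fun v => ?_
    rw [countP_conjParts, filter_congr fun i hi => hlevel i (mem_range.1 hi) v]
    have : (range (Multiset.card s)).filter (fun i => i < c v) = range (c v) := by
      have : c v ≤ Multiset.card s := Multiset.countP_le_card _ _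
      ext i
      simp only [mem_filter, mem_range]
      omega
    rw [this, card_range]

lemma card_gapFree (n : ℕ) :
    Nat.card {c : n.Partition // GapFree c.parts ∧ 2 ≤ c.parts.toFinset.card} =
      (cores n).card := by
  classical
  rw [Nat.card_eq_fintype_card, Fintype.card_subtype]
  symm
  have hmem : ∀ p ∈ cores n, (∀ {i}, i ∈ conjParts p.1 p.2.1 p.2.2 → 0 < i) ∧
      (conjParts p.1 p.2.1 p.2.2).sum = n := by
    rintro ⟨m, r, S⟩ hp
    obtain ⟨hr, hS, h, hs⟩ := mem_cores.1 hp
    refine ⟨fun {i} hi => ?_, by rw [sum_conjParts fun x hx => (h x hx).2.le, hs]⟩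
    obtain ⟨j, _, rfl⟩ := mem_conjParts.1 hi
    exact Nat.add_pos_left hr _
  refine card_bij (fun p hp => ⟨conjParts p.1 p.2.1 p.2.2, (hmem p hp).1, (hmem p hp).2⟩)
    ?_ ?_ ?_
  · rintro ⟨m, r, S⟩ hp
    obtain ⟨hr, hS, h, hs⟩ := mem_cores.1 hp
    exact mem_filter.2 ⟨mem_univ _, gapFree_conjParts m r S, two_le_card_conjParts hS h⟩
  · rintro ⟨m, r, S⟩ hp ⟨m', r', S'⟩ hp' heq
    obtain ⟨hr, hS, h, hs⟩ := mem_cores.1 hp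
    obtain ⟨hr', hS', h', hs'⟩ := mem_cores.1 hp'
    obtain ⟨rfl, rfl, rfl⟩ := conjParts_injective hS h h' (congrArg Nat.Partition.parts heq)
    rfl
  · intro c hc
    obtain ⟨hg, h2⟩ := (mem_filter.1 hc).2
    obtain ⟨m, r, S, hr, hS, h, heq⟩ := exists_conjParts_eq hg h2 fun x hx => c.parts_pos hx
    refine ⟨(m, r, S), mem_cores.2 ⟨hr, hS, h, ?_⟩, Nat.Partition.ext heq⟩
    rw [← sum_conjParts fun x hx => (h x hx).2.le, heq, c.parts_sum]

end GapFreeCount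

/-- For `n ≥ 1`, the number of gap-free partitions of `n` having at least two distinct part
values equals the sum of the smallest parts over all distinct partitions of `n` with an even
number of parts. -/
theorem gap_free_eq_sum_smallest_even (n : ℕ) (hn : 1 ≤ n) :
    Nat.card {c : n.Partition // GapFree c.parts ∧ 2 ≤ c.parts.toFinset.card} =
      ∑ c ∈ (Nat.Partition.distincts n).filter (fun c => Even (Multiset.card c.parts)),
        sInf {p | p ∈ c.parts} := by
  rw [GapFreeCount.card_gapFree, GapFreeCount.sum_sInf_parts n hn,
    ← GapFreeCount.sum_card_triples]
  exact Finset.sum_congr rfl fun k hk => (GapFreeCount.card_markedSets_eq_card_triples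
    (GapFreeCount.mem_evens.1 hk).1.1 n).symm
end

section
/- For every n ≥ 1, the sum of the smallest parts over all partitions of n into distinct parts with an odd number of parts, minus the sum of the smallest parts over all partitions of n into distinct parts with an even number of parts, equals d(n), the number of positive divisors of n. -/
open Finset in
/-- A version of `∑ k q ^ k (q ^ (k + 1); q)_∞ = ∑ q ^ j / (1 - q ^ j)` for nilpotent `q`. -/
theorem sum_mul_pow_mul_prod_one_sub_pow_of_pow_eq_zero {R : Type*} [CommRing R] (q : R) (N : ℕ)
    (hq : q ^ (N + 1) = 0) :
    ∑ k ∈ range (N + 1), (k : R) * q ^ k * ∏ j ∈ Ioc k N, (1 - q ^ j) =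
      ∑ j ∈ range N, q ^ (j + 1) * ∑ m ∈ range (N + 1), (q ^ (j + 1)) ^ m := by
  set a : ℕ → R := fun k => ∏ j ∈ Ioc k N, (1 - q ^ j) with ha
  set u : ℕ → R := fun j => ∑ m ∈ range (N + 1), (q ^ (j + 1)) ^ m with hu
  set e : ℕ → R := fun i => ∑ k ∈ range (N + 1), (q ^ (i + 1)) ^ k * a k with he
  set f : ℕ → R := fun i => ∑ k ∈ range (N + 1), (k : R) * (q ^ (i + 1)) ^ k * a k with hf
  have hqpow : ∀ i, (q ^ (i + 1)) ^ (N + 1) = 0 := fun i => by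
    rw [← pow_mul, mul_comm, pow_mul, hq, zero_pow (by omega)]
  have hqi : ∀ i, q ^ (i + 1) * (q ^ (i + 1)) ^ N = 0 := fun i => by
    rw [← pow_succ', hqpow]
  have ha_succ : ∀ k < N, a k = (1 - q ^ (k + 1)) * a (k + 1) := fun k hk => by
    simp only [ha]
    have hIoc : Ioc k N = insert (k + 1) (Ioc (k + 1) N) := by ext; simp; omega
    rw [hIoc, prod_insert (by simp)]
  have hu_mul : ∀ i, u i * (1 - q ^ (i + 1)) = 1 := fun i => by
    have h := geom_sum_mul_neg (q ^ (i + 1)) (N + 1)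
    rw [hqpow, sub_zero] at h
    exact h
  have he_succ : ∀ i, (1 - q ^ (i + 1)) * e i = e (i + 1) := fun i => by
    have h1 : e i - e (i + 1) = ∑ k ∈ range N, q ^ (i + 1) * ((q ^ (i + 1)) ^ k * a k) := by
      simp only [he]
      rw [← sum_sub_distrib, sum_range_succ']
      simp only [pow_zero, sub_self, add_zero]
      refine sum_congr rfl fun k hk => ?_
      rw [ha_succ k (mem_range.1 hk)]
      ring
    have h2 : q ^ (i + 1) * e i = ∑ k ∈ range N, q ^ (i + 1) * ((q ^ (i + 1)) ^ k * a k) := by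
      simp only [he]
      rw [sum_range_succ, mul_add, ← mul_assoc _ (_ ^ N), hqi, zero_mul, add_zero, mul_sum]
    linear_combination h1 - h2
  have hf_succ : ∀ i, (1 - q ^ (i + 1)) * f i = f (i + 1) + q ^ (i + 1) * e i := fun i => by
    have h1 : f i - f (i + 1) =
        ∑ k ∈ range N, q ^ (i + 1) * (((k : R) + 1) * (q ^ (i + 1)) ^ k * a k) := by
      simp only [hf]
      rw [← sum_sub_distrib, sum_range_succ']
      simp only [Nat.cast_zero, zero_mul, sub_self, add_zero]
      refine sum_congr rfl fun k hk => ?_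
      rw [ha_succ k (mem_range.1 hk)]
      push_cast
      ring
    have h2 : q ^ (i + 1) * (f i + e i) =
        ∑ k ∈ range N, q ^ (i + 1) * (((k : R) + 1) * (q ^ (i + 1)) ^ k * a k) := by
      simp only [hf, he]
      rw [← sum_add_distrib, sum_range_succ, mul_add, mul_sum]
      have : q ^ (i + 1) * ((N : R) * (q ^ (i + 1)) ^ N * a N + (q ^ (i + 1)) ^ N * a N) = 0 := by
        linear_combination ((N : R) + 1) * a N * hqi i
      rw [this, add_zero]
      exact sum_congr rfl fun k _ => by ring
    linear_combination h1 - h2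
  have hqN : ∀ k, (q ^ (N + 1)) ^ (k + 1) = 0 := fun k => by rw [hq, zero_pow (by omega)]
  have heN : e N = ∏ j ∈ range N, (1 - q ^ (j + 1)) := by
    simp only [he]
    rw [sum_range_succ']
    simp only [hqN, zero_mul, sum_const_zero, pow_zero, one_mul, zero_add, ha]
    rw [range_eq_Ico, prod_Ico_add' (fun j => 1 - q ^ j) 0 N 1]
    rfl
  have hfN : f N = 0 := by
    simp only [hf]
    rw [sum_range_succ']
    simp [hqN]
  have he_mul : ∀ i, e i * ∏ j ∈ range i, u j = e 0 := fun i => by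
    induction i with
    | zero => simp
    | succ i ih =>
      rw [prod_range_succ, ← he_succ, ← ih]
      linear_combination e i * (∏ j ∈ range i, u j) * hu_mul i
  have he_zero : e 0 = 1 := by
    rw [← he_mul N, heN, ← prod_mul_distrib]
    exact prod_eq_one fun j _ => by rw [mul_comm, hu_mul]
  have hf_zero : ∀ i, f 0 = f i * ∏ j ∈ range i, u j + ∑ j ∈ range i, q ^ (j + 1) * u j :=
    fun i => by
      induction i with
      | zero => simp
      | succ i ih =>
        rw [prod_range_succ, sum_range_succ, ih]
        have h := he_mul i
        rw [he_zero] at h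
        linear_combination u i * (∏ j ∈ range i, u j) * hf_succ i -
          f i * (∏ j ∈ range i, u j) * hu_mul i + u i * q ^ (i + 1) * h
  have h := hf_zero N
  rw [hfN, zero_mul, zero_add] at h
  simpa [hf] using h

open Finset Polynomial in
/-- The degree `n` coefficient of `∑ k X ^ k (X ^ (k + 1); X)_∞` counts the divisors of `n`. -/
theorem coeff_sum_mul_X_pow_mul_prod_one_sub_X_pow (n : ℕ) :
    (∑ k ∈ range (n + 1), (k : ℤ[X]) * X ^ k * ∏ j ∈ Ioc k n, (1 - X ^ j)).coeff n =
      (n.divisors.card : ℤ) := by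
  have hcongr : (∑ k ∈ range (n + 1), (k : ℤ[X]) * X ^ k * ∏ j ∈ Ioc k n, (1 - X ^ j)).coeff n =
      (∑ j ∈ range n, (X : ℤ[X]) ^ (j + 1) * ∑ m ∈ range (n + 1), (X ^ (j + 1)) ^ m).coeff n := by
    rw [← sub_eq_zero, ← coeff_sub]
    refine X_pow_dvd_iff.1 ?_ n n.lt_succ_self
    rw [← Ideal.mem_span_singleton, ← Ideal.Quotient.eq]
    have h := sum_mul_pow_mul_prod_one_sub_pow_of_pow_eq_zero
      (Ideal.Quotient.mk (Ideal.span {(X : ℤ[X]) ^ (n + 1)}) X) n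
      (by rw [← map_pow, Ideal.Quotient.eq_zero_iff_mem]
          exact Ideal.mem_span_singleton_self _)
    simpa only [map_sum, map_mul, map_prod, map_sub, map_one, map_pow, map_natCast] using h
  have hdiv : n.divisors = (Ico 1 (n + 1)).filter (· ∣ n) := rfl
  rw [hcongr, finsetSum_coeff, hdiv, card_filter,
    ← sum_Ico_add' (fun d => if d ∣ n then 1 else 0) 0 n 1, ← range_eq_Ico, Nat.cast_sum]
  refine sum_congr rfl fun j hjn => ?_
  have hpow : ∀ m, (X : ℤ[X]) ^ (j + 1) * (X ^ (j + 1)) ^ m = X ^ ((j + 1) * (m + 1)) :=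
    fun m => by rw [← pow_succ', ← pow_mul]
  simp only [mul_sum, hpow, finsetSum_coeff, coeff_X_pow]
  split_ifs with hj
  · obtain ⟨m, hm⟩ := hj
    have hm0 : m ≠ 0 := fun h => by simp [h] at hm; simp [hm] at hjn
    have hmn : m ≤ n := hm ▸ Nat.le_mul_of_pos_left m j.succ_pos
    rw [sum_eq_single (m - 1)]
    · rw [Nat.sub_add_cancel (Nat.pos_of_ne_zero hm0), if_pos hm, Nat.cast_one]
    · intro b _ hb
      refine if_neg fun h => hb ?_
      have := Nat.eq_of_mul_eq_mul_left j.succ_pos (hm.symm.trans h)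
      omega
    · intro h
      rw [mem_range] at h
      omega
  · rw [Nat.cast_zero]
    exact sum_eq_zero fun m _ => if_neg fun h => hj ⟨_, h⟩

open Finset Polynomial in
/-- The generating polynomial of the signed smallest elements of the subsets of `Ioc 0 N`. -/
theorem sum_powerset_sInf_mul_X_pow_sum (N : ℕ) :
    ∑ s ∈ (Ioc 0 N).powerset,
        (-1 : ℤ[X]) ^ (#s + 1) * ((sInf {p : ℕ | p ∈ s} : ℕ) : ℤ[X]) * X ^ (∑ p ∈ s, p) =
      ∑ k ∈ range (N + 1), (k : ℤ[X]) * X ^ k * ∏ j ∈ Ioc k N, (1 - X ^ j) := by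
  induction N with
  | zero => simp
  | succ N ih =>
    have hIoc : ∀ k ≤ N, Ioc k (N + 1) = insert (N + 1) (Ioc k N) := fun k hk => by
      ext; simp; omega
    have hright : ∑ k ∈ range (N + 1 + 1), (k : ℤ[X]) * X ^ k * ∏ j ∈ Ioc k (N + 1), (1 - X ^ j) =
        (1 - X ^ (N + 1)) *
          (∑ k ∈ range (N + 1), (k : ℤ[X]) * X ^ k * ∏ j ∈ Ioc k N, (1 - X ^ j)) +
        ((N + 1 : ℕ) : ℤ[X]) * X ^ (N + 1) := by
      rw [sum_range_succ, Ioc_self, prod_empty, mul_one, mul_sum]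
      congr 1
      refine sum_congr rfl fun k hk => ?_
      rw [hIoc k (by simpa [Nat.lt_succ_iff] using hk), prod_insert (by simp)]
      ring
    have hinsert : ∀ s ∈ (Ioc 0 N).powerset, s ≠ ∅ →
        sInf {p : ℕ | p ∈ insert (N + 1) s} = sInf {p : ℕ | p ∈ s} := fun s hs hne => by
      have hmem : sInf {p : ℕ | p ∈ s} ∈ s :=
        Nat.sInf_mem (s := {p : ℕ | p ∈ s}) (nonempty_iff_ne_empty.2 hne)
      have hle := (mem_Ioc.1 (mem_powerset.1 hs hmem)).2
      refine le_antisymm (Nat.sInf_le (mem_insert_of_mem hmem)) ?_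
      refine le_csInf ⟨N + 1, by simp⟩ fun b hb => ?_
      rcases mem_insert.1 hb with rfl | hb
      · omega
      · exact Nat.sInf_le hb
    have hterm : ∀ s ∈ (Ioc 0 N).powerset,
        (-1 : ℤ[X]) ^ (#(insert (N + 1) s) + 1) *
            ((sInf {p : ℕ | p ∈ insert (N + 1) s} : ℕ) : ℤ[X]) *
            X ^ (∑ p ∈ insert (N + 1) s, p) =
          -X ^ (N + 1) * ((-1 : ℤ[X]) ^ (#s + 1) * ((sInf {p : ℕ | p ∈ s} : ℕ) : ℤ[X]) *
            X ^ (∑ p ∈ s, p)) +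
          if s = ∅ then ((N + 1 : ℕ) : ℤ[X]) * X ^ (N + 1) else 0 := fun s hs => by
      by_cases hne : s = ∅
      · subst hne
        simp
      · have hnot : N + 1 ∉ s := fun h => by
          have := (mem_Ioc.1 (mem_powerset.1 hs h)).2
          omega
        rw [hinsert s hs hne, card_insert_of_notMem hnot, sum_insert hnot, if_neg hne]
        ring
    rw [hIoc 0 N.zero_le, sum_powerset_insert (by simp), sum_congr rfl hterm, sum_add_distrib,
      ← mul_sum, sum_ite_eq', if_pos (empty_mem_powerset _), hright, ih]
    ring

open Finset in
/-- A distinct partition of `n` is the same as a set of positive integers with sum `n`. -/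
theorem sum_distincts_eq_sum_powerset (n : ℕ) (F : Multiset ℕ → ℤ) :
    ∑ c ∈ Nat.Partition.distincts n, F c.parts =
      ∑ s ∈ (Ioc 0 n).powerset with ∑ p ∈ s, p = n, F s.val := by
  refine sum_bij' (fun c _ => c.parts.toFinset)
    (fun s hs => ⟨s.val, fun {i} hi => ?_, ?_⟩) ?_ ?_ ?_ ?_ ?_
  · exact (mem_Ioc.1 (mem_powerset.1 (mem_filter.1 hs).1 hi)).1
  · exact (sum_val s).trans (mem_filter.1 hs).2
  · intro c hc
    have hnd : c.parts.Nodup := (mem_filter.1 hc).2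
    refine mem_filter.2 ⟨mem_powerset.2 fun p hp => ?_, ?_⟩
    · rw [Multiset.mem_toFinset] at hp
      exact mem_Ioc.2 ⟨c.parts_pos hp, c.le_of_mem_parts hp⟩
    · refine (sum_val c.parts.toFinset).symm.trans ?_
      rw [Multiset.toFinset_val, hnd.dedup, c.parts_sum]
  · exact fun s _ => mem_filter.2 ⟨mem_univ _, s.nodup⟩
  · intro c hc
    have hnd : c.parts.Nodup := (mem_filter.1 hc).2
    exact Nat.Partition.ext ((Multiset.toFinset_val _).trans hnd.dedup)
  · exact fun s _ => s.val_toFinset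
  · intro c hc
    have hnd : c.parts.Nodup := (mem_filter.1 hc).2
    simp [hnd.dedup]

/-- For `n ≥ 1`, the sum of the smallest parts over all distinct partitions of `n` with an
odd number of parts, minus the corresponding sum over distinct partitions with an even number
of parts, equals the number of positive divisors of `n`. -/
theorem fokkink_fokkink_wang (n : ℕ) (hn : 1 ≤ n) :
    (∑ c ∈ (Nat.Partition.distincts n).filter (fun c => Odd (Multiset.card c.parts)),
        ((sInf {p : ℕ | p ∈ c.parts} : ℕ) : ℤ)) -
      (∑ c ∈ (Nat.Partition.distincts n).filter (fun c => Even (Multiset.card c.parts)),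
        ((sInf {p : ℕ | p ∈ c.parts} : ℕ) : ℤ)) = (n.divisors.card : ℤ) := by
  have hsplit : (∑ c ∈ (Nat.Partition.distincts n).filter (fun c => Odd (Multiset.card c.parts)),
        ((sInf {p : ℕ | p ∈ c.parts} : ℕ) : ℤ)) -
      (∑ c ∈ (Nat.Partition.distincts n).filter (fun c => Even (Multiset.card c.parts)),
        ((sInf {p : ℕ | p ∈ c.parts} : ℕ) : ℤ)) =
      ∑ c ∈ Nat.Partition.distincts n,
        (-1) ^ (Multiset.card c.parts + 1) * ((sInf {p : ℕ | p ∈ c.parts} : ℕ) : ℤ) := by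
    rw [Finset.sum_filter, Finset.sum_filter, ← Finset.sum_sub_distrib]
    refine Finset.sum_congr rfl fun c _ => ?_
    rcases Nat.even_or_odd (Multiset.card c.parts) with h | h
    · rw [if_neg (Nat.not_odd_iff_even.2 h), if_pos h, h.add_one.neg_one_pow]
      ring
    · rw [if_pos h, if_neg (Nat.not_even_iff_odd.2 h), h.add_one.neg_one_pow]
      ring
  rw [hsplit, sum_distincts_eq_sum_powerset n
      (fun m => (-1) ^ (Multiset.card m + 1) * ((sInf {p : ℕ | p ∈ m} : ℕ) : ℤ)),
    ← coeff_sum_mul_X_pow_mul_prod_one_sub_X_pow n, ← sum_powerset_sInf_mul_X_pow_sum,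
    Polynomial.finsetSum_coeff, Finset.sum_filter]
  refine Finset.sum_congr rfl fun s _ => ?_
  have hC : (-1 : Polynomial ℤ) ^ (s.card + 1) * ((sInf {p : ℕ | p ∈ s} : ℕ) : Polynomial ℤ) =
      Polynomial.C ((-1) ^ (s.card + 1) * ((sInf {p : ℕ | p ∈ s} : ℕ) : ℤ)) := by simp
  rw [hC, Polynomial.coeff_C_mul_X_pow]
  simp only [eq_comm (a := n), Finset.card_val, Finset.mem_val]
end
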